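/- Reisner's theorem for zonoids: if Z is a centrally symmetric zonoid in ℝⁿ, then vol(Z)·vol(Z*) ≥ 4ⁿ/n!, with equality if and only if Z is a parallelepiped (the image of the cube [−1,1]ⁿ under an invertible linear map). -/

import Mathlib

open MeasureTheory Filter
open scoped InnerProductSpace Pointwise NNReal ENNReal Topology

noncomputable section

/-- The polar of a set `K` in Euclidean space: `{y | ⟨x,y⟩ ≤ 1 for all x ∈ K}`. -/
def polarSet {n : ℕ} (K : Set (EuclideanSpace ℝ (Fin n))) : Set (EuclideanSpace ℝ (Fin n)) :=
  {y | ∀ x ∈ K, ⟪x, y⟫_ℝ ≤ 1}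

/-- A convex body: a compact convex set with nonempty interior. -/
structure IsConvexBody {n : ℕ} (K : Set (EuclideanSpace ℝ (Fin n))) : Prop where
  convex : Convex ℝ K
  isCompact : IsCompact K
  nonempty_interior : (interior K).Nonempty

/-- A zonotope: a finite Minkowski sum of segments. -/
def IsZonotope {n : ℕ} (Z : Set (EuclideanSpace ℝ (Fin n))) : Prop :=
  ∃ (m : ℕ) (a b : Fin m → EuclideanSpace ℝ (Fin n)),
    Z = ∑ i : Fin m, segment ℝ (a i) (b i)

/-- A zonoid: a convex body which is a limit of zonotopes in the Hausdorff metric. -/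
def IsZonoid {n : ℕ} (Z : Set (EuclideanSpace ℝ (Fin n))) : Prop :=
  IsConvexBody Z ∧ ∃ W : ℕ → Set (EuclideanSpace ℝ (Fin n)),
    (∀ k, IsZonotope (W k)) ∧
    Tendsto (fun k => Metric.hausdorffDist (W k) Z) atTop (nhds 0)

/-- The cube `[-1,1]ⁿ`. -/
def stdCube (n : ℕ) : Set (EuclideanSpace ℝ (Fin n)) :=
  {x | ∀ i, |x i| ≤ 1}

section Slicing

variable {E : Type*} [NormedAddCommGroup E] [InnerProductSpace ℝ E] [FiniteDimensional ℝ E]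
  [MeasurableSpace E] [BorelSpace E]

theorem measurePreserving_smul_add_orthogonal {v : E} (hv : ‖v‖ = 1) :
    MeasurePreserving (fun q : ℝ × (ℝ ∙ v)ᗮ => q.1 • v + (q.2 : E)) := by
  have h1 : MeasurePreserving
      (Prod.map (LinearIsometryEquiv.toSpanUnitSingleton (𝕜 := ℝ) v hv) id :
        ℝ × (ℝ ∙ v)ᗮ → (ℝ ∙ v) × (ℝ ∙ v)ᗮ) :=
    (LinearIsometryEquiv.measurePreserving _).prod (MeasurePreserving.id _)
  have h2 := (WithLp.volume_preserving_toLp (ℝ ∙ v) (ℝ ∙ v)ᗮ).comp h1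
  have h3 := ((ℝ ∙ v).orthogonalDecomposition.symm.measurePreserving).comp h2
  convert! h3 using 1

theorem lintegral_eq_lintegral_lintegral_orthogonal {v : E} (hv : ‖v‖ = 1) {f : E → ℝ≥0∞}
    (hf : Measurable f) :
    ∫⁻ x, f x = ∫⁻ y : (ℝ ∙ v)ᗮ, ∫⁻ t : ℝ, f (t • v + y) := by
  have h := measurePreserving_smul_add_orthogonal hv
  rw [← h.lintegral_comp hf, Measure.volume_eq_prod, lintegral_prod_symm']
  exact hf.comp h.measurable

theorem lintegral_eq_lintegral_lintegral_orthogonal' {v : E} (hv : ‖v‖ = 1) {f : E → ℝ≥0∞}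
    (hf : Measurable f) :
    ∫⁻ x, f x = ∫⁻ t : ℝ, ∫⁻ y : (ℝ ∙ v)ᗮ, f (t • v + y) := by
  have h := measurePreserving_smul_add_orthogonal hv
  rw [← h.lintegral_comp hf, Measure.volume_eq_prod, lintegral_prod]
  exact (hf.comp h.measurable).aemeasurable

end Slicing

section PrekopaLeindler

theorem volume_add_volume_le_of_compact {K L C : Set ℝ} (hK : IsCompact K) (hL : IsCompact L)
    (hKne : K.Nonempty) (hLne : L.Nonempty) (h : ∀ x ∈ K, ∀ y ∈ L, x + y ∈ C) :
    volume K + volume L ≤ volume C := by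
  obtain ⟨α, hα, hα'⟩ := hK.exists_isGreatest hKne
  obtain ⟨β, hβ, hβ'⟩ := hL.exists_isLeast hLne
  have e1 : volume ((fun x => x + β) '' K) = volume K := by
    rw [Set.image_add_right, measure_preimage_add_right]
  have e2 : volume ((fun x => α + x) '' L) = volume L := by
    rw [Set.image_add_left, measure_preimage_add]
  have hm : MeasurableSet ((fun x => α + x) '' L) :=
    (hL.image (by fun_prop)).measurableSet
  have h0 : volume ((fun x => x + β) '' K ∩ (fun x => α + x) '' L) = 0 := by
    refine measure_mono_null (t := {α + β}) ?_ (by simp)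
    rintro _ ⟨⟨x, hx, rfl⟩, ⟨y, hy, hxy⟩⟩
    have := hα' hx
    have := hβ' hy
    simp only [Set.mem_singleton_iff] at *
    linarith
  rw [← e1, ← e2, ← measure_union_add_inter _ hm, h0, add_zero]
  refine measure_mono ?_
  rintro _ (⟨x, hx, rfl⟩ | ⟨y, hy, rfl⟩)
  · exact h _ hx _ hβ
  · exact h _ hα _ hy

theorem volume_add_volume_le {A B C : Set ℝ} (hA : MeasurableSet A) (hB : MeasurableSet B)
    (hAne : A.Nonempty) (hBne : B.Nonempty) (h : ∀ x ∈ A, ∀ y ∈ B, x + y ∈ C) :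
    volume A + volume B ≤ volume C := by
  obtain ⟨a, ha⟩ := hAne
  obtain ⟨b, hb⟩ := hBne
  rw [hA.measure_eq_iSup_isCompact, hB.measure_eq_iSup_isCompact]
  simp only [iSup_and']
  refine ENNReal.biSup_add_biSup_le' ⟨∅, by simp⟩ ⟨∅, by simp⟩ ?_
  rintro K ⟨hKA, hK⟩ L ⟨hLB, hL⟩
  refine (add_le_add (measure_mono (Set.subset_insert a K))
    (measure_mono (Set.subset_insert b L))).trans ?_
  refine volume_add_volume_le_of_compact (hK.insert a) (hL.insert b) (by simp) (by simp) ?_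
  intro x hx y hy
  exact h x (Set.insert_subset ha hKA hx) y (Set.insert_subset hb hLB hy)

theorem ENNReal.rpow_mul_rpow_le_add {a b : ℝ} (ha : 0 < a) (hb : 0 < b) (hab : a + b = 1)
    (x y : ℝ≥0∞) : x ^ a * y ^ b ≤ ENNReal.ofReal a * x + ENNReal.ofReal b * y := by
  have ha' : ENNReal.ofReal a ≠ 0 := by simpa using ha
  have hb' : ENNReal.ofReal b ≠ 0 := by simpa using hb
  rcases eq_or_ne x ∞ with rfl | hx
  · simp [ENNReal.mul_top ha']
  rcases eq_or_ne y ∞ with rfl | hy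
  · simp [ENNReal.mul_top hb']
  lift x to ℝ≥0 using hx
  lift y to ℝ≥0 using hy
  rw [ENNReal.ofReal_eq_coe_nnreal ha.le, ENNReal.ofReal_eq_coe_nnreal hb.le,
    ← ENNReal.coe_rpow_of_nonneg x ha.le, ← ENNReal.coe_rpow_of_nonneg y hb.le]
  exact_mod_cast NNReal.geom_mean_le_arith_mean2_weighted ⟨a, ha.le⟩ ⟨b, hb.le⟩ x y
    (NNReal.eq hab)

theorem lintegral_add_lintegral_le_of_sup_one {a b : ℝ} (ha : 0 < a) (hb : 0 < b)
    {f g h : ℝ → ℝ≥0∞} (hf : Measurable f) (hg : Measurable g) (hh : Measurable h)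
    (hf1 : ⨆ x, f x = 1) (hg1 : ⨆ x, g x = 1) (hab : a + b = 1)
    (H : ∀ x y, f x ^ a * g y ^ b ≤ h (a * x + b * y)) :
    ENNReal.ofReal a * (∫⁻ x, f x) + ENNReal.ofReal b * (∫⁻ x, g x) ≤ ∫⁻ x, h x := by
  have key : ∀ k : ℝ → ℝ≥0∞, Measurable k → (∀ x, k x ≤ 1) →
      ∫⁻ x, k x = ∫⁻ t in Set.Ioo (0 : ℝ) 1, volume {x | ENNReal.ofReal t < k x} := by
    intro k hk hk1
    have hfin : ∀ x, k x ≠ ∞ := fun x => ((hk1 x).trans_lt ENNReal.one_lt_top).ne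
    have h1 := lintegral_eq_lintegral_meas_lt (volume : Measure ℝ) (f := fun x => (k x).toReal)
      (Eventually.of_forall fun x => ENNReal.toReal_nonneg) hk.ennreal_toReal.aemeasurable
    simp only [ENNReal.ofReal_toReal (hfin _)] at h1
    rw [h1, ← Set.Ioo_union_Ici_eq_Ioi (zero_lt_one' ℝ),
      lintegral_union measurableSet_Ici (by
        rw [Set.disjoint_left]; rintro x ⟨_, h1⟩ h2; exact absurd h1 (not_lt.2 h2))]
    have h2 : ∫⁻ t in Set.Ici (1 : ℝ), volume {x | t < (k x).toReal} = 0 := by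
      rw [setLIntegral_congr_fun (g := fun _ => 0) measurableSet_Ici]
      · simp
      · intro t ht
        have : {x | t < (k x).toReal} = ∅ := by
          ext x
          simp only [Set.mem_ofPred_eq, Set.mem_empty_iff_false, iff_false, not_lt]
          refine le_trans ?_ ht
          exact ENNReal.toReal_le_of_le_ofReal zero_le_one (by simpa using hk1 x)
        simp [this]
    rw [h2, add_zero]
    refine setLIntegral_congr_fun measurableSet_Ioo fun t ht => ?_
    congr 1
    ext x
    simp only [Set.mem_ofPred_eq]
    rw [ENNReal.ofReal_lt_iff_lt_toReal ht.1.le (hfin x)]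
  have hfle : ∀ x, f x ≤ 1 := fun x => hf1 ▸ le_iSup f x
  have hgle : ∀ x, g x ≤ 1 := fun x => hg1 ▸ le_iSup g x
  have hm : ∫⁻ x, min (h x) 1 ≤ ∫⁻ x, h x := lintegral_mono fun x => min_le_left _ _
  refine le_trans ?_ hm
  rw [key f hf hfle, key g hg hgle, key _ (hh.min measurable_const) fun x => min_le_right _ _]
  have anti : ∀ k : ℝ → ℝ≥0∞, Measurable fun t : ℝ => volume {x | ENNReal.ofReal t < k x} :=
    fun k => Antitone.measurable fun s t hst => measure_mono fun x hx =>
      (ENNReal.ofReal_le_ofReal hst).trans_lt hx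
  rw [← lintegral_const_mul _ (anti f), ← lintegral_const_mul _ (anti g),
    ← lintegral_add_left ((anti f).const_mul _)]
  refine setLIntegral_mono (anti _) fun t ht => ?_
  have ht1 : ENNReal.ofReal t < 1 := by
    rw [← ENNReal.ofReal_one]; exact (ENNReal.ofReal_lt_ofReal_iff zero_lt_one).2 ht.2
  have e : ∀ (c : ℝ) (hc : 0 < c) (S : Set ℝ), ENNReal.ofReal c * volume S = volume (c • S) := by
    intro c hc S
    rw [Measure.addHaar_smul]
    simp [abs_of_pos hc]
  rw [e a ha, e b hb]
  obtain ⟨x₀, hx₀⟩ := lt_iSup_iff.1 (hf1.symm ▸ ht1)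
  obtain ⟨y₀, hy₀⟩ := lt_iSup_iff.1 (hg1.symm ▸ ht1)
  refine volume_add_volume_le ?_ ?_ ?_ ?_ ?_
  · exact (measurableSet_lt measurable_const hf).const_smul₀ a
  · exact (measurableSet_lt measurable_const hg).const_smul₀ b
  · exact Set.Nonempty.smul_set ⟨x₀, hx₀⟩
  · exact Set.Nonempty.smul_set ⟨y₀, hy₀⟩
  rintro _ ⟨x, hx, rfl⟩ _ ⟨y, hy, rfl⟩
  simp only [Set.mem_ofPred_eq, smul_eq_mul, lt_min_iff] at *
  refine ⟨lt_of_lt_of_le ?_ (H x y), ht1⟩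
  have e1 : ENNReal.ofReal t = ENNReal.ofReal t ^ a * ENNReal.ofReal t ^ b := by
    rw [← ENNReal.rpow_add_of_nonneg _ _ ha.le hb.le, hab, ENNReal.rpow_one]
  rw [e1]
  exact ENNReal.mul_lt_mul (ENNReal.rpow_lt_rpow hx ha) (ENNReal.rpow_lt_rpow hy hb)

theorem prekopa_leindler_real_of_bounded {a b : ℝ} (ha : 0 < a) (hb : 0 < b) (hab : a + b = 1)
    {f g h : ℝ → ℝ≥0∞} (hf : Measurable f) (hg : Measurable g) (hh : Measurable h)
    {c : ℝ≥0} (hfc : ∀ x, f x ≤ c) (hgc : ∀ x, g x ≤ c)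
    (H : ∀ x y, f x ^ a * g y ^ b ≤ h (a * x + b * y)) :
    (∫⁻ x, f x) ^ a * (∫⁻ x, g x) ^ b ≤ ∫⁻ x, h x := by
  set M := ⨆ x, f x with hM
  set N := ⨆ x, g x with hN
  have hMt : M ≠ ∞ := ((iSup_le hfc).trans_lt ENNReal.coe_lt_top).ne
  have hNt : N ≠ ∞ := ((iSup_le hgc).trans_lt ENNReal.coe_lt_top).ne
  rcases eq_or_ne M 0 with hM0 | hM0
  · have : ∀ x, f x = 0 := fun x => le_antisymm (hM0 ▸ le_iSup f x) bot_le
    simp [this, ha]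
  rcases eq_or_ne N 0 with hN0 | hN0
  · have : ∀ x, g x = 0 := fun x => le_antisymm (hN0 ▸ le_iSup g x) bot_le
    simp [this, hb]
  have hMa0 : M ^ a ≠ 0 := by simp [hM0, hMt]
  have hMat : M ^ a ≠ ∞ := by simp [hM0, hMt]
  have hNa0 : N ^ b ≠ 0 := by simp [hN0, hNt]
  have hNat : N ^ b ≠ ∞ := by simp [hN0, hNt]
  have h1 := lintegral_add_lintegral_le_of_sup_one ha hb (f := fun x => M⁻¹ * f x)
    (g := fun x => N⁻¹ * g x) (h := fun x => (M ^ a * N ^ b)⁻¹ * h x)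
    (hf.const_mul _) (hg.const_mul _) (hh.const_mul _)
    (by rw [← ENNReal.mul_iSup, ← hM, ENNReal.inv_mul_cancel hM0 hMt])
    (by rw [← ENNReal.mul_iSup, ← hN, ENNReal.inv_mul_cancel hN0 hNt]) hab (by
      intro x y
      rw [ENNReal.mul_rpow_of_nonneg _ _ ha.le, ENNReal.mul_rpow_of_nonneg _ _ hb.le,
        ENNReal.inv_rpow, ENNReal.inv_rpow, ENNReal.mul_inv (Or.inl hMa0) (Or.inl hMat)]
      calc _ = (M ^ a)⁻¹ * (N ^ b)⁻¹ * (f x ^ a * g y ^ b) := by ring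
        _ ≤ _ := by gcongr; exact H x y)
  rw [lintegral_const_mul _ hf, lintegral_const_mul _ hg, lintegral_const_mul _ hh] at h1
  have h2 := (ENNReal.rpow_mul_rpow_le_add ha hb hab _ _).trans h1
  rw [ENNReal.mul_rpow_of_nonneg _ _ ha.le, ENNReal.mul_rpow_of_nonneg _ _ hb.le,
        ENNReal.inv_rpow, ENNReal.inv_rpow] at h2
  rw [mul_mul_mul_comm, ← ENNReal.mul_inv (Or.inl hMa0) (Or.inl hMat)] at h2
  exact (ENNReal.mul_le_mul_iff_right (by simp [ENNReal.mul_eq_top, hMa0, hMat, hNa0, hNat])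
    (by simp [hMa0, hNa0])).1 h2

theorem lintegral_min_natCast_tendsto {α : Type*} [MeasurableSpace α] (μ : Measure α)
    {f : α → ℝ≥0∞} (hf : Measurable f) :
    Tendsto (fun k : ℕ => ∫⁻ x, min (f x) k ∂μ) atTop (𝓝 (∫⁻ x, f x ∂μ)) := by
  refine lintegral_tendsto_of_tendsto_of_monotone
    (fun k => (hf.min measurable_const).aemeasurable) ?_ ?_
  · refine Eventually.of_forall fun x i j hij => ?_
    exact min_le_min_left _ (by exact_mod_cast hij)
  · refine Eventually.of_forall fun x => ?_
    have := (tendsto_const_nhds (x := f x)).min ENNReal.tendsto_nat_nhds_top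
    simpa using this

theorem prekopa_leindler_real {a b : ℝ} (ha : 0 < a) (hb : 0 < b) (hab : a + b = 1)
    {f g h : ℝ → ℝ≥0∞} (hf : Measurable f) (hg : Measurable g) (hh : Measurable h)
    (H : ∀ x y, f x ^ a * g y ^ b ≤ h (a * x + b * y)) :
    (∫⁻ x, f x) ^ a * (∫⁻ x, g x) ^ b ≤ ∫⁻ x, h x := by
  rcases eq_or_ne (∫⁻ x, f x) 0 with hf0 | hf0
  · simp [hf0, ha]
  rcases eq_or_ne (∫⁻ x, g x) 0 with hg0 | hg0
  · simp [hg0, hb]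
  have hlim : Tendsto (fun k : ℕ => (∫⁻ x, min (f x) k) ^ a * (∫⁻ x, min (g x) k) ^ b) atTop
      (𝓝 ((∫⁻ x, f x) ^ a * (∫⁻ x, g x) ^ b)) := by
    refine ENNReal.Tendsto.mul ?_ (Or.inl ?_) ?_ (Or.inl ?_)
    · exact (ENNReal.continuous_rpow_const.tendsto _).comp (lintegral_min_natCast_tendsto _ hf)
    · simp [hf0, ha.le, ha]
    · exact (ENNReal.continuous_rpow_const.tendsto _).comp (lintegral_min_natCast_tendsto _ hg)
    · simp [hg0, hb.le, hb]
  refine le_of_tendsto' hlim fun k => ?_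
  refine prekopa_leindler_real_of_bounded (c := k) ha hb hab (hf.min measurable_const)
    (hg.min measurable_const) hh (by simp) (by simp) fun x y => le_trans ?_ (H x y)
  gcongr <;> exact min_le_left _ _

theorem prekopa_leindler_pi {a b : ℝ} (ha : 0 < a) (hb : 0 < b) (hab : a + b = 1) (n : ℕ)
    {f g h : (Fin n → ℝ) → ℝ≥0∞} (hf : Measurable f) (hg : Measurable g) (hh : Measurable h)
    (H : ∀ x y, f x ^ a * g y ^ b ≤ h (a • x + b • y)) :
    (∫⁻ x, f x) ^ a * (∫⁻ x, g x) ^ b ≤ ∫⁻ x, h x := by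
  induction n with
  | zero =>
    rw [volume_pi, Measure.pi_of_empty (x := 0)]
    simp only [lintegral_dirac]
    convert H 0 0 using 2
  | succ n ih =>
    have hmp := (volume_preserving_piFinSuccAbove (fun _ : Fin (n + 1) => ℝ) 0).symm
    have e : ∀ k : (Fin (n + 1) → ℝ) → ℝ≥0∞, Measurable k →
        ∫⁻ x, k x = ∫⁻ t : ℝ, ∫⁻ y : Fin n → ℝ, k (Fin.cons t y) := by
      intro k hk
      rw [← hmp.lintegral_comp hk, Measure.volume_eq_prod, lintegral_prod]
      · simp [MeasurableEquiv.piFinSuccAbove_symm_apply, Fin.insertNthEquiv]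
      · exact (hk.comp hmp.measurable).aemeasurable
    have hcons : Measurable fun q : ℝ × (Fin n → ℝ) => (Fin.cons q.1 q.2 : Fin (n + 1) → ℝ) := by
      convert! hmp.measurable using 1
      ext q i
      simp [MeasurableEquiv.piFinSuccAbove_symm_apply, Fin.insertNthEquiv]
    have m2 : ∀ k : (Fin (n + 1) → ℝ) → ℝ≥0∞, Measurable k →
        Measurable fun q : ℝ × (Fin n → ℝ) => k (Fin.cons q.1 q.2) := fun k hk =>
      hk.comp hcons
    rw [e f hf, e g hg, e h hh]
    refine prekopa_leindler_real ha hb hab (m2 f hf).lintegral_prod_right'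
      (m2 g hg).lintegral_prod_right' (m2 h hh).lintegral_prod_right' fun s t => ?_
    refine ih ((m2 f hf).comp measurable_prodMk_left) ((m2 g hg).comp measurable_prodMk_left)
      ((m2 h hh).comp measurable_prodMk_left) fun x y => ?_
    convert H (Fin.cons s x) (Fin.cons t y) using 2
    ext i
    refine Fin.cases ?_ (fun j => ?_) i <;> simp

/-- The **Prékopa–Leindler inequality** on a finite-dimensional inner product space. -/
theorem prekopa_leindler {F : Type*} [NormedAddCommGroup F] [InnerProductSpace ℝ F]
    [FiniteDimensional ℝ F] [MeasurableSpace F] [BorelSpace F]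
    {a b : ℝ} (ha : 0 < a) (hb : 0 < b) (hab : a + b = 1)
    {f g h : F → ℝ≥0∞} (hf : Measurable f) (hg : Measurable g) (hh : Measurable h)
    (H : ∀ x y, f x ^ a * g y ^ b ≤ h (a • x + b • y)) :
    (∫⁻ x, f x) ^ a * (∫⁻ x, g x) ^ b ≤ ∫⁻ x, h x := by
  have hmp := ((stdOrthonormalBasis ℝ F).measurePreserving_repr_symm).comp
    (PiLp.volume_preserving_toLp (Fin (Module.finrank ℝ F)))
  rw [← hmp.lintegral_comp hf, ← hmp.lintegral_comp hg, ← hmp.lintegral_comp hh]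
  refine prekopa_leindler_pi ha hb hab _ (hf.comp hmp.measurable) (hg.comp hmp.measurable)
    (hh.comp hmp.measurable) fun x y => ?_
  simpa using H _ _

end PrekopaLeindler

section ExpIntegral

variable {E : Type*} [NormedAddCommGroup E] [InnerProductSpace ℝ E] [FiniteDimensional ℝ E]

theorem Seminorm.continuous_of_finiteDimensional (p : Seminorm ℝ E) : Continuous p := by
  rw [← continuousOn_univ]
  exact p.convexOn.continuousOn isOpen_univ

theorem Seminorm.exists_mul_norm_le (p : Seminorm ℝ E) (hp : ∀ x, p x = 0 → x = 0) :
    ∃ r : ℝ, 0 < r ∧ ∀ x, r * ‖x‖ ≤ p x := by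
  rcases subsingleton_or_nontrivial E with h | h
  · exact ⟨1, one_pos, fun x => by simp [Subsingleton.elim x 0]⟩
  obtain ⟨x₀, hx₀, hmin⟩ := (isCompact_sphere (0 : E) 1).exists_isMinOn
    (NormedSpace.sphere_nonempty.2 zero_le_one) p.continuous_of_finiteDimensional.continuousOn
  refine ⟨p x₀, lt_of_le_of_ne (apply_nonneg p _) fun h0 => ?_, fun x => ?_⟩
  · have := hp _ h0.symm
    simp [this] at hx₀
  · rcases eq_or_ne x 0 with rfl | hx
    · simp
    have hx' : 0 < ‖x‖ := norm_pos_iff.2 hx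
    have h1 : p x₀ ≤ p (‖x‖⁻¹ • x) := hmin (by simp [norm_smul, hx'.ne'])
    rw [map_smul_eq_mul, norm_inv, norm_norm, ← div_eq_inv_mul, le_div_iff₀ hx'] at h1
    exact h1

variable [MeasurableSpace E] [BorelSpace E]

/-- The integral of `exp (-p)`. -/
def expIntegral (p : Seminorm ℝ E) : ℝ≥0∞ := ∫⁻ x, ENNReal.ofReal (Real.exp (-p x))

theorem Seminorm.measurable_exp_neg (p : Seminorm ℝ E) :
    Measurable fun x => ENNReal.ofReal (Real.exp (-p x)) :=
  (ENNReal.continuous_ofReal.comp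
    (Real.continuous_exp.comp p.continuous_of_finiteDimensional.neg)).measurable

theorem volume_lt_one_eq_ofReal (p : Seminorm ℝ E) (hp : ∀ x, p x = 0 → x = 0) :
    volume {x | p x < 1} =
      ENNReal.ofReal ((∫ x, Real.exp (-p x)) / (Module.finrank ℝ E).factorial) := by
  have := measure_lt_one_eq_integral_div_gamma (volume : Measure E) (g := p) (map_zero p)
    (map_neg_eq_map p) (map_add_le_add p) (fun {x} => hp x)
    (fun r x => (map_smul_eq_mul p r x).le) one_pos
  simpa [Real.Gamma_nat_eq_factorial] using this

theorem integrable_exp_neg (p : Seminorm ℝ E) (hp : ∀ x, p x = 0 → x = 0) :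
    Integrable fun x => Real.exp (-p x) := by
  by_contra h
  have h1 := volume_lt_one_eq_ofReal p hp
  rw [integral_undef h] at h1
  have h2 : IsOpen {x | p x < 1} :=
    isOpen_lt p.continuous_of_finiteDimensional continuous_const
  have h3 := h2.measure_pos volume ⟨0, by simp⟩
  simp [h1] at h3

theorem expIntegral_eq_ofReal_integral (p : Seminorm ℝ E) (hp : ∀ x, p x = 0 → x = 0) :
    expIntegral p = ENNReal.ofReal (∫ x, Real.exp (-p x)) := by
  rw [ofReal_integral_eq_lintegral_ofReal (integrable_exp_neg p hp)
    (Eventually.of_forall fun x => (Real.exp_pos _).le)]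
  rfl

theorem expIntegral_ne_top (p : Seminorm ℝ E) (hp : ∀ x, p x = 0 → x = 0) :
    expIntegral p ≠ ∞ := by
  simp [expIntegral_eq_ofReal_integral p hp]

theorem expIntegral_ne_zero (p : Seminorm ℝ E) : expIntegral p ≠ 0 := by
  rw [expIntegral, Ne, lintegral_eq_zero_iff p.measurable_exp_neg]
  intro h
  have : (volume : Measure E) = 0 := by
    rw [← ae_eq_bot, ← eventually_false_iff_eq_bot]
    filter_upwards [h] with x hx
    simp only [Pi.zero_apply, ENNReal.ofReal_eq_zero] at hx
    exact absurd hx (not_le.2 (Real.exp_pos _))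
  exact NeZero.ne _ this

theorem volume_le_one_eq (p : Seminorm ℝ E) (hp : ∀ x, p x = 0 → x = 0) :
    volume {x | p x ≤ 1} = expIntegral p / (Module.finrank ℝ E).factorial := by
  have h1 : volume {x | p x < 1} = expIntegral p / (Module.finrank ℝ E).factorial := by
    rw [volume_lt_one_eq_ofReal p hp, expIntegral_eq_ofReal_integral p hp,
      ENNReal.ofReal_div_of_pos (by positivity), ENNReal.ofReal_natCast]
  rw [← h1]
  rcases subsingleton_or_nontrivial E with h | h
  · congr 1
    ext x
    simp [Subsingleton.elim x 0]
  · exact measure_le_eq_lt (volume : Measure E) (g := p) (map_zero p)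
      (map_neg_eq_map p) (map_add_le_add p) (fun {x} => hp x)
      (fun r x => (map_smul_eq_mul p r x).le) 1

theorem lintegral_comp_smul_eq (f : E → ℝ≥0∞) (hf : Measurable f) {s : ℝ} (hs : 0 < s) :
    ∫⁻ x, f (s • x) = ENNReal.ofReal (s ^ Module.finrank ℝ E)⁻¹ * ∫⁻ x, f x := by
  have h := Measure.map_addHaar_smul (volume : Measure E) hs.ne'
  have h2 : ∫⁻ x, f x ∂(Measure.map (s • ·) (volume : Measure E)) = ∫⁻ x, f (s • x) :=
    lintegral_map hf (measurable_const_smul s)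
  rw [← h2, h, lintegral_smul_measure, abs_of_pos (by positivity), smul_eq_mul]

theorem finrank_mul_expIntegral_le (p : Seminorm ℝ E) (hp : ∀ x, p x = 0 → x = 0) :
    Module.finrank ℝ E * expIntegral p ≤
      ∫⁻ x, ENNReal.ofReal (p x) * ENNReal.ofReal (Real.exp (-p x)) := by
  set N := Module.finrank ℝ E with hN
  set J := ∫⁻ x, ENNReal.ofReal (p x) * ENNReal.ofReal (Real.exp (-p x)) with hJ
  rcases eq_or_ne J ∞ with hJt | hJt
  · simp [hJt]
  set I := (expIntegral p).toReal
  have hI : expIntegral p = ENNReal.ofReal I := (ENNReal.ofReal_toReal (expIntegral_ne_top p hp)).symm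
  have hI0 : 0 ≤ I := ENNReal.toReal_nonneg
  have key : ∀ ε : ℝ, 0 < ε → N * I ≤ J.toReal * (1 + N * ε) := by
    intro ε hε
    have hm : Measurable fun x : E => ENNReal.ofReal (Real.exp (-p ((1 + ε) • x))) :=
      p.measurable_exp_neg.comp (measurable_const_smul _)
    have h1 : expIntegral p ≤ ENNReal.ofReal ε * J +
        ENNReal.ofReal ((1 + ε) ^ N)⁻¹ * expIntegral p := by
      rw [expIntegral, hN, ← lintegral_comp_smul_eq _ p.measurable_exp_neg (by positivity), hJ,
        ← lintegral_const_mul' _ _ (by simp), ← lintegral_add_right _ hm]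
      refine lintegral_mono fun x => ?_
      have hx : 0 ≤ p x := apply_nonneg p x
      rw [← ENNReal.ofReal_mul hx, ← ENNReal.ofReal_mul hε.le, ← ENNReal.ofReal_add (by positivity)
        (by positivity)]
      refine ENNReal.ofReal_le_ofReal ?_
      rw [map_smul_eq_mul, Real.norm_of_nonneg (by positivity)]
      have e : Real.exp (-((1 + ε) * p x)) = Real.exp (-(ε * p x)) * Real.exp (-p x) := by
        rw [← Real.exp_add]; ring_nf
      have := Real.add_one_le_exp (-(ε * p x))
      rw [e]
      nlinarith [Real.exp_pos (-p x)]
    rw [hI, ← ENNReal.ofReal_toReal hJt, ← ENNReal.ofReal_mul hε.le,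
      ← ENNReal.ofReal_mul (by positivity),
      ← ENNReal.ofReal_add (by positivity) (by positivity),
      ENNReal.ofReal_le_ofReal_iff (by positivity)] at h1
    have h2 := one_add_mul_le_pow (a := ε) (by linarith) N
    have h3 : ((1 + ε) ^ N)⁻¹ ≤ (1 + N * ε)⁻¹ := by
      gcongr
    have h4 : I ≤ ε * J.toReal + (1 + N * ε)⁻¹ * I := by nlinarith
    have h5 : I * (1 + N * ε) ≤ ε * J.toReal * (1 + N * ε) + I := by
      have : (0:ℝ) < 1 + N * ε := by positivity
      calc I * (1 + N * ε) ≤ (ε * J.toReal + (1 + N * ε)⁻¹ * I) * (1 + N * ε) := by gcongr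
        _ = _ := by field_simp
    have h6 : ε * (N * I) ≤ ε * (J.toReal * (1 + N * ε)) := by linarith
    exact le_of_mul_le_mul_left h6 hε
  have hlim : Tendsto (fun ε : ℝ => J.toReal * (1 + N * ε)) (𝓝[>] 0) (𝓝 (J.toReal * (1 + N * 0))) :=
    (Continuous.tendsto (by fun_prop) 0).mono_left nhdsWithin_le_nhds
  have h7 : N * I ≤ J.toReal * (1 + N * 0) :=
    ge_of_tendsto hlim (eventually_mem_nhdsWithin.mono fun ε hε => key ε hε)
  rw [hI, ← ENNReal.ofReal_toReal hJt, ← ENNReal.ofReal_natCast, ← ENNReal.ofReal_mul (by positivity)]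
  exact ENNReal.ofReal_le_ofReal (by simpa using h7)

theorem lintegral_abs_inner_mul_exp_ne_top (p : Seminorm ℝ E) (hp : ∀ x, p x = 0 → x = 0) (v : E) :
    ∫⁻ x, ENNReal.ofReal |⟪v, x⟫_ℝ| * ENNReal.ofReal (Real.exp (-p x)) ≠ ∞ := by
  obtain ⟨r, hr, hrp⟩ := p.exists_mul_norm_le hp
  have h1 := lintegral_comp_smul_eq _ p.measurable_exp_neg (show (0 : ℝ) < 1 / 2 by norm_num)
  refine ne_top_of_le_ne_top (b := ∫⁻ x, ENNReal.ofReal (2 * ‖v‖ / r) *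
    ENNReal.ofReal (Real.exp (-p ((1 / 2 : ℝ) • x)))) ?_ (lintegral_mono fun x => ?_)
  · rw [lintegral_const_mul' _ _ (by simp), h1]
    exact ENNReal.mul_ne_top (by simp) (ENNReal.mul_ne_top (by simp) (expIntegral_ne_top p hp))
  · rw [← ENNReal.ofReal_mul (by positivity), ← ENNReal.ofReal_mul (by positivity)]
    refine ENNReal.ofReal_le_ofReal ?_
    rw [map_smul_eq_mul, Real.norm_of_nonneg (by norm_num)]
    have e : Real.exp (-p x) = Real.exp (-(1 / 2 * p x)) * Real.exp (-(1 / 2 * p x)) := by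
      rw [← Real.exp_add]; ring_nf
    have h2 : |⟪v, x⟫_ℝ| ≤ ‖v‖ * ‖x‖ := abs_real_inner_le_norm v x
    have h3 : ‖x‖ ≤ p x / r := by rw [le_div_iff₀ hr]; linarith [hrp x]
    have h4 := Real.add_one_le_exp (1 / 2 * p x)
    have h5 : (1 / 2 * p x) * Real.exp (-(1 / 2 * p x)) ≤ 1 := by
      rw [Real.exp_neg, ← div_eq_mul_inv, div_le_one (Real.exp_pos _)]
      linarith
    rw [e, ← mul_assoc]
    gcongr
    calc |⟪v, x⟫_ℝ| * Real.exp (-(1 / 2 * p x)) ≤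
        (‖v‖ * (p x / r)) * Real.exp (-(1 / 2 * p x)) := by
          gcongr; exact h2.trans (by gcongr)
      _ = 2 * ‖v‖ / r * ((1 / 2 * p x) * Real.exp (-(1 / 2 * p x))) := by ring
      _ ≤ 2 * ‖v‖ / r * 1 := by gcongr
      _ = _ := by ring

end ExpIntegral

section HalfLine

theorem lintegral_eq_two_mul_of_even {f : ℝ → ℝ≥0∞} (h : ∀ t, f (-t) = f t) :
    ∫⁻ t, f t = 2 * ∫⁻ t in Set.Ioi 0, f t := by
  have h1 : ∫⁻ t in Set.Iio 0, f t = ∫⁻ t in Set.Ioi 0, f t := by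
    have := (Measure.measurePreserving_neg (volume : Measure ℝ)).setLIntegral_comp_preimage_emb
      (MeasurableEquiv.neg ℝ).measurableEmbedding f (Set.Iio 0)
    rw [← this]
    simp [h]
  rw [← lintegral_add_compl f (measurableSet_Iio (a := (0 : ℝ))), Set.compl_Iio,
    setLIntegral_congr Ioi_ae_eq_Ici.symm, h1, two_mul]

theorem lintegral_lintegral_comp_add {f : ℝ → ℝ≥0∞} (hf : Measurable f) :
    ∫⁻ s in Set.Ioi (0 : ℝ), ∫⁻ r in Set.Ioi (0 : ℝ), f (s + r) =
      ∫⁻ t in Set.Ioi (0 : ℝ), ENNReal.ofReal t * f t := by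
  have h1 : ∀ s : ℝ, 0 < s → ∫⁻ r in Set.Ioi (0 : ℝ), f (s + r) =
      ∫⁻ t in Set.Ioi (0 : ℝ), (Set.Iio t).indicator (fun _ => f t) s := by
    intro s hs
    rw [← lintegral_indicator measurableSet_Ioi, ← lintegral_indicator measurableSet_Ioi]
    symm
    rw [← lintegral_add_left_eq_self _ s]
    refine lintegral_congr fun r => ?_
    by_cases hr : 0 < r
    · have : 0 < s + r := by linarith
      simp [Set.indicator, hr, this]
    · by_cases h2 : 0 < s + r <;> simp [Set.indicator, hr, h2]
  rw [setLIntegral_congr_fun measurableSet_Ioi h1, lintegral_lintegral_swap]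
  · refine setLIntegral_congr_fun measurableSet_Ioi fun t ht => ?_
    rw [lintegral_indicator measurableSet_Iio, Measure.restrict_restrict measurableSet_Iio,
      setLIntegral_const, Set.Iio_inter_Ioi, Real.volume_Ioo, mul_comm, sub_zero]
  · have : (Function.uncurry fun s t : ℝ => (Set.Iio t).indicator (fun _ => f t) s) =
        {q : ℝ × ℝ | q.1 < q.2}.indicator (fun q => f q.2) := by
      ext ⟨s, t⟩
      simp [Set.indicator]
    rw [this]
    exact ((hf.comp measurable_snd).indicator (measurableSet_lt measurable_fst measurable_snd)).aemeasurable

end HalfLine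

section Sections

variable {E : Type*} [NormedAddCommGroup E] [InnerProductSpace ℝ E] [FiniteDimensional ℝ E]
  [MeasurableSpace E] [BorelSpace E]

/-- The integral of `exp (-p)` over the hyperplane `t • v + vᗮ`. -/
def sectionIntegral (p : Seminorm ℝ E) (v : E) (t : ℝ) : ℝ≥0∞ :=
  ∫⁻ y : (ℝ ∙ v)ᗮ, ENNReal.ofReal (Real.exp (-p (t • v + y)))

theorem sectionIntegral_zero (p : Seminorm ℝ E) (v : E) :
    sectionIntegral p v 0 = expIntegral (p.comp (ℝ ∙ v)ᗮ.subtype) := by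
  simp [sectionIntegral, expIntegral]

theorem sectionIntegral_neg (p : Seminorm ℝ E) (v : E) (t : ℝ) :
    sectionIntegral p v (-t) = sectionIntegral p v t := by
  rw [sectionIntegral, sectionIntegral, ← lintegral_neg_eq_self]
  refine lintegral_congr fun y => ?_
  rw [← map_neg_eq_map p]
  congr 4
  simp [add_comm]

theorem sectionIntegral_measurable_slice (p : Seminorm ℝ E) (v : E) (t : ℝ) :
    Measurable fun y : (ℝ ∙ v)ᗮ => ENNReal.ofReal (Real.exp (-p (t • v + y))) :=
  p.measurable_exp_neg.comp (measurable_const.add measurable_subtype_coe)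

theorem sectionIntegral_le (p : Seminorm ℝ E) (v : E) (t s : ℝ) :
    sectionIntegral p v t ≤
      ENNReal.ofReal (Real.exp (p v * |t - s|)) * sectionIntegral p v s := by
  rw [sectionIntegral, sectionIntegral,
    ← lintegral_const_mul _ (sectionIntegral_measurable_slice p v s)]
  refine lintegral_mono fun y => ?_
  rw [← ENNReal.ofReal_mul (Real.exp_pos _).le, ← Real.exp_add]
  refine ENNReal.ofReal_le_ofReal (Real.exp_le_exp.2 ?_)
  have h := map_add_le_add p ((s - t) • v) (t • v + y)
  rw [map_smul_eq_mul, Real.norm_eq_abs, abs_sub_comm] at h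
  have h2 : (s - t) • v + (t • v + (y : E)) = s • v + y := by module
  rw [h2] at h
  linarith

theorem sectionIntegral_ne_top (p : Seminorm ℝ E) (hp : ∀ x, p x = 0 → x = 0) (v : E) (t : ℝ) :
    sectionIntegral p v t ≠ ∞ := by
  refine ne_top_of_le_ne_top (ENNReal.mul_ne_top ENNReal.ofReal_ne_top ?_)
    (sectionIntegral_le p v t 0)
  rw [sectionIntegral_zero]
  exact expIntegral_ne_top _ fun x hx => Subtype.ext (hp _ hx)

theorem sectionIntegral_ne_zero (p : Seminorm ℝ E) (v : E) (t : ℝ) :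
    sectionIntegral p v t ≠ 0 := by
  intro h
  have := sectionIntegral_le p v 0 t
  rw [h, mul_zero, sectionIntegral_zero] at this
  exact expIntegral_ne_zero _ (le_antisymm this zero_le)

theorem continuous_sectionIntegral (p : Seminorm ℝ E) (v : E) :
    Continuous (sectionIntegral p v) := by
  rw [continuous_iff_continuousAt]
  intro s
  have hc : ∀ L : ℝ, Tendsto (fun t => ENNReal.ofReal (Real.exp (L * |t - s|)) *
      sectionIntegral p v s) (𝓝 s) (𝓝 (sectionIntegral p v s)) := by
    intro L
    have h1 : Continuous fun t : ℝ => ENNReal.ofReal (Real.exp (L * |t - s|)) :=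
      ENNReal.continuous_ofReal.comp (by fun_prop)
    have h2 := ENNReal.Tendsto.mul_const (b := sectionIntegral p v s) (h1.tendsto s)
      (Or.inl (by simp))
    simpa using h2
  refine tendsto_of_tendsto_of_tendsto_of_le_of_le (hc (-p v)) (hc (p v)) (fun t => ?_)
    (fun t => sectionIntegral_le p v t s)
  calc _ ≤ ENNReal.ofReal (Real.exp (-p v * |t - s|)) *
        (ENNReal.ofReal (Real.exp (p v * |s - t|)) * sectionIntegral p v t) := by
        gcongr; exact sectionIntegral_le p v s t
    _ = sectionIntegral p v t := by
        rw [← mul_assoc, ← ENNReal.ofReal_mul (Real.exp_pos _).le, ← Real.exp_add,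
          abs_sub_comm s t]
        simp

theorem sectionIntegral_rpow_mul_rpow_le (p : Seminorm ℝ E) (v : E) {a b : ℝ} (ha : 0 < a)
    (hb : 0 < b) (hab : a + b = 1) (s t : ℝ) :
    sectionIntegral p v s ^ a * sectionIntegral p v t ^ b ≤
      sectionIntegral p v (a * s + b * t) := by
  refine prekopa_leindler ha hb hab (sectionIntegral_measurable_slice p v s)
    (sectionIntegral_measurable_slice p v t) (sectionIntegral_measurable_slice p v _) ?_
  intro x y
  rw [ENNReal.ofReal_rpow_of_nonneg (Real.exp_pos _).le ha.le,
    ENNReal.ofReal_rpow_of_nonneg (Real.exp_pos _).le hb.le,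
    ← ENNReal.ofReal_mul (by positivity), ← Real.exp_mul, ← Real.exp_mul, ← Real.exp_add]
  refine ENNReal.ofReal_le_ofReal (Real.exp_le_exp.2 ?_)
  have h := map_add_le_add p (a • (s • v + (x : E))) (b • (t • v + (y : E)))
  rw [map_smul_eq_mul, map_smul_eq_mul, Real.norm_of_nonneg ha.le, Real.norm_of_nonneg hb.le] at h
  have h2 : a • (s • v + (x : E)) + b • (t • v + (y : E)) =
      (a * s + b * t) • v + ((a • x + b • y : (ℝ ∙ v)ᗮ) : E) := by
    push_cast
    module
  rw [h2] at h
  linarith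

theorem sectionIntegral_zero_mul_add_le (p : Seminorm ℝ E) (v : E) {s r : ℝ} (hs : 0 < s)
    (hr : 0 < r) : sectionIntegral p v 0 * sectionIntegral p v (s + r) ≤
      sectionIntegral p v s * sectionIntegral p v r := by
  have ha : 0 < r / (s + r) := by positivity
  have hb : 0 < s / (s + r) := by positivity
  have hab : r / (s + r) + s / (s + r) = 1 := by field_simp; ring
  have h1 := sectionIntegral_rpow_mul_rpow_le p v ha hb hab 0 (s + r)
  have h2 := sectionIntegral_rpow_mul_rpow_le p v hb ha (by linarith) 0 (s + r)
  have e1 : r / (s + r) * 0 + s / (s + r) * (s + r) = s := by field_simp; ring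
  have e2 : s / (s + r) * 0 + r / (s + r) * (s + r) = r := by field_simp; ring
  rw [e1] at h1
  rw [e2] at h2
  refine le_trans (le_of_eq ?_) (mul_le_mul' h1 h2)
  rw [mul_mul_mul_comm, ← ENNReal.rpow_add_of_nonneg _ _ ha.le hb.le,
    ← ENNReal.rpow_add_of_nonneg _ _ hb.le ha.le, hab, add_comm (s / (s + r)), hab]
  simp

theorem expIntegral_eq_two_mul (p : Seminorm ℝ E) {v : E} (hv : ‖v‖ = 1) :
    expIntegral p = 2 * ∫⁻ t in Set.Ioi 0, sectionIntegral p v t := by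
  rw [expIntegral, lintegral_eq_lintegral_lintegral_orthogonal' hv p.measurable_exp_neg]
  exact lintegral_eq_two_mul_of_even (sectionIntegral_neg p v)

theorem lintegral_abs_inner_mul_exp_eq (p : Seminorm ℝ E) {v : E} (hv : ‖v‖ = 1) :
    ∫⁻ x, ENNReal.ofReal |⟪v, x⟫_ℝ| * ENNReal.ofReal (Real.exp (-p x)) =
      2 * ∫⁻ t in Set.Ioi 0, ENNReal.ofReal t * sectionIntegral p v t := by
  have hm : Measurable fun x => ENNReal.ofReal |⟪v, x⟫_ℝ| * ENNReal.ofReal (Real.exp (-p x)) :=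
    Measurable.mul (by fun_prop) p.measurable_exp_neg
  rw [lintegral_eq_lintegral_lintegral_orthogonal' hv hm]
  have h1 : ∀ t : ℝ, ∫⁻ y : (ℝ ∙ v)ᗮ, ENNReal.ofReal |⟪v, t • v + y⟫_ℝ| *
      ENNReal.ofReal (Real.exp (-p (t • v + y))) =
      ENNReal.ofReal |t| * sectionIntegral p v t := by
    intro t
    rw [sectionIntegral, ← lintegral_const_mul _ (sectionIntegral_measurable_slice p v t)]
    refine lintegral_congr fun y => ?_
    have h0 : ⟪v, (y : E)⟫_ℝ = 0 := Submodule.mem_orthogonal_singleton_iff_inner_right.1 y.2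
    rw [inner_add_right, inner_smul_right, real_inner_self_eq_norm_sq, hv, h0]
    simp
  simp_rw [h1]
  rw [lintegral_eq_two_mul_of_even fun t => by rw [abs_neg, sectionIntegral_neg]]
  congr 1
  refine setLIntegral_congr_fun measurableSet_Ioi fun t ht => ?_
  rw [abs_of_pos (Set.mem_Ioi.1 ht)]

theorem measurable_sectionIntegral (p : Seminorm ℝ E) (v : E) :
    Measurable (sectionIntegral p v) := (continuous_sectionIntegral p v).measurable

theorem sectionIntegral_zero_mul_eq (p : Seminorm ℝ E) (v : E) :
    sectionIntegral p v 0 * ∫⁻ t in Set.Ioi 0, ENNReal.ofReal t * sectionIntegral p v t =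
      ∫⁻ q in Set.Ioi (0 : ℝ) ×ˢ Set.Ioi (0 : ℝ),
        sectionIntegral p v 0 * sectionIntegral p v (q.1 + q.2) := by
  have hm := measurable_sectionIntegral p v
  rw [← lintegral_lintegral_comp_add hm, lintegral_const_mul _ (by fun_prop),
    Measure.volume_eq_prod, ← Measure.prod_restrict, lintegral_prod _ (by fun_prop)]

theorem lintegral_sectionIntegral_sq (p : Seminorm ℝ E) (v : E) :
    (∫⁻ t in Set.Ioi 0, sectionIntegral p v t) ^ 2 =
      ∫⁻ q in Set.Ioi (0 : ℝ) ×ˢ Set.Ioi (0 : ℝ),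
        sectionIntegral p v q.1 * sectionIntegral p v q.2 := by
  have hm := measurable_sectionIntegral p v
  rw [Measure.volume_eq_prod, ← Measure.prod_restrict,
    lintegral_prod_mul hm.aemeasurable hm.aemeasurable, sq]

theorem two_mul_expIntegral_section_mul_le (p : Seminorm ℝ E) {v : E} (hv : ‖v‖ = 1) :
    2 * (expIntegral (p.comp (ℝ ∙ v)ᗮ.subtype) *
      ∫⁻ x, ENNReal.ofReal |⟪v, x⟫_ℝ| * ENNReal.ofReal (Real.exp (-p x))) ≤
      expIntegral p ^ 2 := by
  rw [lintegral_abs_inner_mul_exp_eq p hv, expIntegral_eq_two_mul p hv, ← sectionIntegral_zero,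
    mul_pow, lintegral_sectionIntegral_sq, mul_left_comm _ (2 : ℝ≥0∞), sectionIntegral_zero_mul_eq,
    ← mul_assoc, sq (2 : ℝ≥0∞)]
  gcongr 2 * 2 * ?_
  exact setLIntegral_mono' (measurableSet_Ioi.prod measurableSet_Ioi) fun q hq =>
    sectionIntegral_zero_mul_add_le p v hq.1 hq.2

theorem sectionIntegral_mul_eq_of_eq (p : Seminorm ℝ E) (hp : ∀ x, p x = 0 → x = 0) {v : E}
    (hv : ‖v‖ = 1)
    (h : expIntegral p ^ 2 ≤ 2 * (expIntegral (p.comp (ℝ ∙ v)ᗮ.subtype) *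
      ∫⁻ x, ENNReal.ofReal |⟪v, x⟫_ℝ| * ENNReal.ofReal (Real.exp (-p x))))
    {s r : ℝ} (hs : 0 < s) (hr : 0 < r) :
    sectionIntegral p v 0 * sectionIntegral p v (s + r) =
      sectionIntegral p v s * sectionIntegral p v r := by
  have hfin := expIntegral_ne_top p hp
  have hm := measurable_sectionIntegral p v
  have hS : MeasurableSet (Set.Ioi (0 : ℝ) ×ˢ Set.Ioi (0 : ℝ)) :=
    measurableSet_Ioi.prod measurableSet_Ioi
  rw [lintegral_abs_inner_mul_exp_eq p hv, expIntegral_eq_two_mul p hv, ← sectionIntegral_zero,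
    mul_pow, lintegral_sectionIntegral_sq, mul_left_comm _ (2 : ℝ≥0∞), sectionIntegral_zero_mul_eq,
    ← mul_assoc, sq (2 : ℝ≥0∞), ENNReal.mul_le_mul_iff_right (by simp) (by finiteness)] at h
  have hle : ∀ᵐ q ∂(volume.restrict (Set.Ioi (0 : ℝ) ×ˢ Set.Ioi (0 : ℝ))),
      sectionIntegral p v 0 * sectionIntegral p v (q.1 + q.2) ≤
        sectionIntegral p v q.1 * sectionIntegral p v q.2 := by
    rw [ae_restrict_iff' hS]
    exact Eventually.of_forall fun q hq => sectionIntegral_zero_mul_add_le p v hq.1 hq.2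
  have hne : ∫⁻ q in Set.Ioi (0 : ℝ) ×ˢ Set.Ioi (0 : ℝ),
        sectionIntegral p v 0 * sectionIntegral p v (q.1 + q.2) ≠ ∞ := by
    refine ne_top_of_le_ne_top ?_ (lintegral_mono_ae hle)
    rw [← lintegral_sectionIntegral_sq]
    refine ENNReal.pow_ne_top fun h' => hfin ?_
    rw [expIntegral_eq_two_mul p hv, h']
    simp
  have hae := ae_eq_of_ae_le_of_lintegral_le hle hne (by fun_prop) h
  have hc := continuous_sectionIntegral p v
  have h1 : Continuous fun q : ℝ × ℝ =>
      sectionIntegral p v 0 * sectionIntegral p v (q.1 + q.2) :=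
    (ENNReal.continuous_const_mul (sectionIntegral_ne_top p hp v 0)).comp
      (hc.comp (continuous_fst.add continuous_snd))
  have h2 : Continuous fun q : ℝ × ℝ => sectionIntegral p v q.1 * sectionIntegral p v q.2 := by
    rw [continuous_iff_continuousAt]
    intro q
    exact ENNReal.Tendsto.mul ((hc.comp continuous_fst).tendsto q)
      (Or.inr (sectionIntegral_ne_top p hp v _)) ((hc.comp continuous_snd).tendsto q)
      (Or.inr (sectionIntegral_ne_top p hp v _))
  exact Measure.eqOn_open_of_ae_eq hae (isOpen_Ioi.prod isOpen_Ioi) h1.continuousOn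
    h2.continuousOn (show (s, r) ∈ _ from ⟨hs, hr⟩)

end Sections

section SectionEquality

variable {E : Type*} [NormedAddCommGroup E] [InnerProductSpace ℝ E]

theorem Seminorm.exists_isMin_add_orthogonal [FiniteDimensional ℝ E] (p : Seminorm ℝ E) (hp : ∀ x, p x = 0 → x = 0)
    (v : E) : ∃ y₀ : (ℝ ∙ v)ᗮ, ∀ y : (ℝ ∙ v)ᗮ, p (v + y₀) ≤ p (v + y) := by
  have hpc := p.continuous_of_finiteDimensional
  obtain ⟨r, hr, hrp⟩ := p.exists_mul_norm_le hp
  refine Continuous.exists_forall_le (f := fun y : (ℝ ∙ v)ᗮ => p (v + y)) (by fun_prop) ?_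
  have h1 : Tendsto (fun y : (ℝ ∙ v)ᗮ => r * (‖y‖ - ‖v‖)) (cocompact _) atTop :=
    (tendsto_atTop_add_const_right _ _ (tendsto_norm_cocompact_atTop)).const_mul_atTop hr
  refine tendsto_atTop_mono (fun y => ?_) h1
  refine le_trans ?_ (hrp _)
  gcongr
  have := norm_sub_le (v + (y : E)) v
  rw [add_sub_cancel_left] at this
  rw [Submodule.coe_norm]
  linarith

theorem Seminorm.mul_le_smul_add (p : Seminorm ℝ E) {v : E} {y₀ : (ℝ ∙ v)ᗮ}
    (h : ∀ y : (ℝ ∙ v)ᗮ, p (v + y₀) ≤ p (v + y)) {t : ℝ} (ht : 0 < t) (y : (ℝ ∙ v)ᗮ) :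
    t * p (v + y₀) ≤ p (t • v + y) := by
  have h1 := h (t⁻¹ • y)
  have h2 : t • v + (y : E) = t • (v + ((t⁻¹ • y : (ℝ ∙ v)ᗮ) : E)) := by
    rw [smul_add, Submodule.coe_smul, smul_inv_smul₀ ht.ne']
  rw [h2, map_smul_eq_mul, Real.norm_of_nonneg ht.le]
  gcongr

theorem Seminorm.smul_add_le (p : Seminorm ℝ E) {v : E} (y₀ : (ℝ ∙ v)ᗮ) (t : ℝ)
    (y : (ℝ ∙ v)ᗮ) : p (t • v + y) ≤ |t| * p (v + y₀) + p ((y - t • y₀ : (ℝ ∙ v)ᗮ) : E) := by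
  have h := map_add_le_add p (t • (v + (y₀ : E))) ((y - t • y₀ : (ℝ ∙ v)ᗮ) : E)
  rw [map_smul_eq_mul, Real.norm_eq_abs] at h
  have h2 : t • v + (y : E) = t • (v + (y₀ : E)) + ((y - t • y₀ : (ℝ ∙ v)ᗮ) : E) := by
    push_cast
    module
  rwa [h2]

variable [FiniteDimensional ℝ E] [MeasurableSpace E] [BorelSpace E]

theorem lintegral_exp_sub_smul (p : Seminorm ℝ E) {v : E} (y₀ : (ℝ ∙ v)ᗮ) (t : ℝ) :
    ∫⁻ y : (ℝ ∙ v)ᗮ, ENNReal.ofReal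
      (Real.exp (-(|t| * p (v + y₀) + p ((y - t • y₀ : (ℝ ∙ v)ᗮ) : E)))) =
      ENNReal.ofReal (Real.exp (-(|t| * p (v + y₀)))) * sectionIntegral p v 0 := by
  rw [sectionIntegral, ← lintegral_const_mul _ (sectionIntegral_measurable_slice p v 0),
    ← lintegral_sub_right_eq_self
      (fun y : (ℝ ∙ v)ᗮ => _ * ENNReal.ofReal (Real.exp (-p ((0 : ℝ) • v + y)))) (t • y₀)]
  refine lintegral_congr fun y => ?_
  rw [← ENNReal.ofReal_mul (Real.exp_pos _).le, ← Real.exp_add, zero_smul, zero_add, neg_add]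

theorem sectionIntegral_two_mul_le (p : Seminorm ℝ E) {v : E} {y₀ : (ℝ ∙ v)ᗮ}
    (h : ∀ y : (ℝ ∙ v)ᗮ, p (v + y₀) ≤ p (v + y)) {t : ℝ} (ht : 0 < t) :
    sectionIntegral p v (2 * t) ≤ ENNReal.ofReal (2 ^ Module.finrank ℝ (ℝ ∙ v)ᗮ) *
      (ENNReal.ofReal (Real.exp (-(t * p (v + y₀)))) * sectionIntegral p v t) := by
  have h1 := lintegral_comp_smul_eq _ (sectionIntegral_measurable_slice p v t)
    (show (0 : ℝ) < 1 / 2 by norm_num)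
  have h2 : sectionIntegral p v (2 * t) ≤ ENNReal.ofReal (Real.exp (-(t * p (v + y₀)))) *
      ∫⁻ y : (ℝ ∙ v)ᗮ, ENNReal.ofReal
        (Real.exp (-p (t • v + (((1 / 2 : ℝ) • y : (ℝ ∙ v)ᗮ) : E)))) := by
    rw [sectionIntegral, ← lintegral_const_mul' _ _ ENNReal.ofReal_ne_top]
    refine lintegral_mono fun y => ?_
    rw [← ENNReal.ofReal_mul (Real.exp_pos _).le, ← Real.exp_add]
    refine ENNReal.ofReal_le_ofReal (Real.exp_le_exp.2 ?_)
    have h3 := p.mul_le_smul_add h ht ((1 / 2 : ℝ) • y)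
    have h4 : (2 * t) • v + (y : E) =
        (2 : ℝ) • (t • v + (((1 / 2 : ℝ) • y : (ℝ ∙ v)ᗮ) : E)) := by
      rw [Submodule.coe_smul]
      module
    rw [h4, map_smul_eq_mul, Real.norm_ofNat]
    linarith
  refine h2.trans (le_of_eq ?_)
  rw [h1, sectionIntegral]
  simp only [one_div, inv_pow, inv_inv]
  ring

theorem sectionIntegral_le_exp_mul (p : Seminorm ℝ E) (hp : ∀ x, p x = 0 → x = 0) {v : E}
    {y₀ : (ℝ ∙ v)ᗮ} (h : ∀ y : (ℝ ∙ v)ᗮ, p (v + y₀) ≤ p (v + y))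
    (hF : ∀ s r : ℝ, 0 < s → 0 < r → sectionIntegral p v 0 * sectionIntegral p v (s + r) =
      sectionIntegral p v s * sectionIntegral p v r) {t : ℝ} (ht : 0 < t) :
    sectionIntegral p v t ≤
      ENNReal.ofReal (Real.exp (-(t * p (v + y₀)))) * sectionIntegral p v 0 := by
  set c := p (v + y₀) with hc
  set A : ℝ := 2 ^ Module.finrank ℝ (ℝ ∙ v)ᗮ with hA
  set F : ℝ → ℝ := fun t => (sectionIntegral p v t).toReal with hFdef
  have hpos : ∀ t, 0 < F t := fun t =>
    ENNReal.toReal_pos (sectionIntegral_ne_zero p v t) (sectionIntegral_ne_top p hp v t)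
  have hFm : ∀ s r : ℝ, 0 < s → 0 < r → F 0 * F (s + r) = F s * F r := by
    intro s r hs hr
    simp only [hFdef, ← ENNReal.toReal_mul, hF s r hs hr]
  have h2 : ∀ t : ℝ, 0 < t → F t ≤ A * Real.exp (-(t * c)) * F 0 := by
    intro t ht
    have h3 := ENNReal.toReal_mono (by finiteness [sectionIntegral_ne_top p hp v t])
      (sectionIntegral_two_mul_le p h ht)
    rw [ENNReal.toReal_mul, ENNReal.toReal_mul, ENNReal.toReal_ofReal (by positivity),
      ENNReal.toReal_ofReal (by positivity)] at h3
    change F (2 * t) ≤ A * (Real.exp (-(t * c)) * F t) at h3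
    have h4 := hFm t t ht ht
    rw [← two_mul] at h4
    have h5 := mul_le_mul_of_nonneg_left h3 (hpos 0).le
    rw [h4] at h5
    refine le_of_mul_le_mul_right ?_ (hpos t)
    linarith
  have hpow : ∀ m : ℕ, F t ^ (m + 1) = F 0 ^ m * F ((m + 1 : ℕ) * t) := by
    intro m
    induction m with
    | zero => simp
    | succ m ih =>
      rw [pow_succ, ih, pow_succ, mul_assoc, mul_assoc, ← hFm _ _ (by positivity) ht]
      congr 4
      push_cast
      ring
  have hle : F t ≤ Real.exp (-(t * c)) * F 0 := by
    by_contra! hlt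
    have hlt' : 1 < F t / (Real.exp (-(t * c)) * F 0) :=
      (one_lt_div (mul_pos (Real.exp_pos _) (hpos 0))).2 hlt
    obtain ⟨m, hm⟩ := pow_unbounded_of_one_lt A hlt'
    have hm' : A < (F t / (Real.exp (-(t * c)) * F 0)) ^ (m + 1) :=
      hm.trans_le (pow_le_pow_right₀ hlt'.le (Nat.le_succ m))
    rw [div_pow, lt_div_iff₀ (by have := hpos 0; positivity), hpow, mul_pow, ← Real.exp_nat_mul,
      pow_succ (F 0)] at hm'
    have h5 := h2 ((m + 1 : ℕ) * t) (by positivity)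
    have h6 := mul_le_mul_of_nonneg_left h5 (pow_pos (hpos 0) m).le
    have e : ((m + 1 : ℕ) : ℝ) * -(t * c) = -((m + 1 : ℕ) * t * c) := by ring
    rw [e] at hm'
    linarith
  have h7 := ENNReal.ofReal_le_ofReal hle
  rwa [ENNReal.ofReal_mul (Real.exp_pos _).le, ENNReal.ofReal_toReal
    (sectionIntegral_ne_top p hp v _), ENNReal.ofReal_toReal (sectionIntegral_ne_top p hp v _)] at h7

theorem Seminorm.smul_add_eq_of_sectionIntegral_mul (p : Seminorm ℝ E)
    (hp : ∀ x, p x = 0 → x = 0) {v : E} {y₀ : (ℝ ∙ v)ᗮ}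
    (h : ∀ y : (ℝ ∙ v)ᗮ, p (v + y₀) ≤ p (v + y))
    (hF : ∀ s r : ℝ, 0 < s → 0 < r → sectionIntegral p v 0 * sectionIntegral p v (s + r) =
      sectionIntegral p v s * sectionIntegral p v r) {t : ℝ} (ht : 0 < t) (y : (ℝ ∙ v)ᗮ) :
    p (t • v + y) = |t| * p (v + y₀) + p ((y - t • y₀ : (ℝ ∙ v)ᗮ) : E) := by
  have hpc := p.continuous_of_finiteDimensional
  have h1 : ∀ y : (ℝ ∙ v)ᗮ, ENNReal.ofReal
      (Real.exp (-(|t| * p (v + y₀) + p ((y - t • y₀ : (ℝ ∙ v)ᗮ) : E)))) ≤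
      ENNReal.ofReal (Real.exp (-p (t • v + y))) := fun y =>
    ENNReal.ofReal_le_ofReal (Real.exp_le_exp.2 (neg_le_neg (p.smul_add_le y₀ t y)))
  have h2 := ae_eq_of_ae_le_of_lintegral_le (Eventually.of_forall h1)
    (by
      rw [lintegral_exp_sub_smul]
      exact ENNReal.mul_ne_top ENNReal.ofReal_ne_top (sectionIntegral_ne_top p hp v 0))
    (sectionIntegral_measurable_slice p v t).aemeasurable
    (by
      rw [lintegral_exp_sub_smul, abs_of_pos ht]
      exact sectionIntegral_le_exp_mul p hp h hF ht)
  have h3 := (Continuous.ae_eq_iff_eq volume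
    (ENNReal.continuous_ofReal.comp (by fun_prop))
    (ENNReal.continuous_ofReal.comp (by fun_prop))).1 h2
  have h4 : ENNReal.ofReal _ = ENNReal.ofReal _ := congrFun h3 y
  rw [ENNReal.ofReal_eq_ofReal_iff (Real.exp_pos _).le (Real.exp_pos _).le, Real.exp_eq_exp] at h4
  linarith

theorem Seminorm.exists_smul_add_eq (p : Seminorm ℝ E) (hp : ∀ x, p x = 0 → x = 0) {v : E}
    (hv : ‖v‖ = 1)
    (h : expIntegral p ^ 2 ≤ 2 * (expIntegral (p.comp (ℝ ∙ v)ᗮ.subtype) *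
      ∫⁻ x, ENNReal.ofReal |⟪v, x⟫_ℝ| * ENNReal.ofReal (Real.exp (-p x)))) :
    ∃ (c : ℝ) (y₀ : (ℝ ∙ v)ᗮ), ∀ (t : ℝ) (y : (ℝ ∙ v)ᗮ),
      p (t • v + y) = |t| * c + p ((y - t • y₀ : (ℝ ∙ v)ᗮ) : E) := by
  obtain ⟨y₀, hy₀⟩ := p.exists_isMin_add_orthogonal hp v
  refine ⟨p (v + y₀), y₀, fun t y => ?_⟩
  have hF := fun s r (hs : (0 : ℝ) < s) (hr : (0 : ℝ) < r) =>
    sectionIntegral_mul_eq_of_eq p hp hv h hs hr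
  rcases lt_trichotomy t 0 with ht | rfl | ht
  · have h1 := p.smul_add_eq_of_sectionIntegral_mul hp hy₀ hF (neg_pos.2 ht) (-y)
    rw [abs_neg, ← map_neg_eq_map p, ← map_neg_eq_map p ((_ : (ℝ ∙ v)ᗮ) : E)] at h1
    convert h1 using 3
    · push_cast
      module
    · push_cast
      module
  · simp
  · exact p.smul_add_eq_of_sectionIntegral_mul hp hy₀ hF ht y

end SectionEquality

section SegmentVolume

theorem volume_add_Icc_of_convex {T : Set ℝ} (hc : Convex ℝ T) (hk : IsCompact T)
    (hne : T.Nonempty) {s : ℝ} (hs : 0 ≤ s) :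
    volume (T + Set.Icc 0 s) = volume T + ENNReal.ofReal s := by
  have h1 := eq_Icc_of_connected_compact ⟨hne, hc.isPreconnected⟩ hk
  have h2 : sInf T ≤ sSup T := Real.sInf_le_sSup T hk.bddBelow hk.bddAbove
  rw [h1, Set.Icc_add_Icc h2 hs, Real.volume_Icc, Real.volume_Icc,
    ← ENNReal.ofReal_add (sub_nonneg.2 h2) hs]
  congr 1
  ring

variable {E : Type*} [NormedAddCommGroup E] [InnerProductSpace ℝ E]

theorem mem_image_orthogonalProjectionOnto_iff {v : E} (hv : ‖v‖ = 1) {V : Set E}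
    {y : (ℝ ∙ v)ᗮ} :
    y ∈ (ℝ ∙ v)ᗮ.orthogonalProjectionOnto '' V ↔ {t : ℝ | t • v + (y : E) ∈ V}.Nonempty := by
  constructor
  · rintro ⟨z, hz, rfl⟩
    refine ⟨⟪v, z⟫_ℝ, ?_⟩
    have h := (ℝ ∙ v).starProjection_add_starProjection_orthogonal z
    rw [Submodule.starProjection_unit_singleton ℝ hv] at h
    simpa only [Set.mem_ofPred_eq, Submodule.coe_orthogonalProjectionOnto_apply, h] using hz
  · rintro ⟨t, ht⟩
    refine ⟨_, ht, ?_⟩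
    rw [map_add, map_smul,
      Submodule.orthogonalProjectionOnto_orthogonalComplement_singleton_eq_zero,
      Submodule.orthogonalProjectionOnto_mem_subspace_eq_self, smul_zero, zero_add]

variable [FiniteDimensional ℝ E] [MeasurableSpace E] [BorelSpace E]

theorem volume_eq_lintegral_volume_fiber {v : E} (hv : ‖v‖ = 1) {S : Set E}
    (hS : MeasurableSet S) :
    volume S = ∫⁻ y : (ℝ ∙ v)ᗮ, volume {t : ℝ | t • v + (y : E) ∈ S} := by
  rw [← lintegral_indicator_one hS,
    lintegral_eq_lintegral_lintegral_orthogonal hv (measurable_one.indicator hS)]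
  refine lintegral_congr fun y => ?_
  have hm : MeasurableSet {t : ℝ | t • v + (y : E) ∈ S} :=
    (show Measurable fun t : ℝ => t • v + (y : E) by fun_prop) hS
  rw [← lintegral_indicator_one hm]
  rfl

theorem volume_add_segment {V : Set E} (hV : Convex ℝ V) (hVk : IsCompact V) {v : E}
    (hv : ‖v‖ = 1) {s : ℝ} (hs : 0 ≤ s) :
    volume (V + segment ℝ 0 (s • v)) =
      volume V + ENNReal.ofReal s * volume ((ℝ ∙ v)ᗮ.orthogonalProjectionOnto '' V) := by
  have hseg : segment ℝ 0 (s • v) = (fun t : ℝ => t • v) '' Set.Icc 0 s := by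
    rw [← segment_eq_Icc hs]
    have := image_segment ℝ (LinearMap.toSpanSingleton ℝ E v).toAffineMap 0 s
    simpa using this.symm
  have hk : IsCompact (V + segment ℝ 0 (s • v)) := by
    rw [hseg]
    exact hVk.add (isCompact_Icc.image (by fun_prop))
  have hPm : MeasurableSet ((ℝ ∙ v)ᗮ.orthogonalProjectionOnto '' V) :=
    (hVk.image (ContinuousLinearMap.continuous _)).measurableSet
  have hfib : ∀ y : (ℝ ∙ v)ᗮ, volume {t : ℝ | t • v + (y : E) ∈ V + segment ℝ 0 (s • v)} =
      volume {t : ℝ | t • v + (y : E) ∈ V} +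
      ((ℝ ∙ v)ᗮ.orthogonalProjectionOnto '' V).indicator (fun _ => ENNReal.ofReal s) y := by
    intro y
    have h1 : {t : ℝ | t • v + (y : E) ∈ V + segment ℝ 0 (s • v)} =
        {t : ℝ | t • v + (y : E) ∈ V} + Set.Icc 0 s := by
      ext t
      rw [hseg]
      simp only [Set.mem_ofPred_eq, Set.mem_add, Set.mem_image]
      constructor
      · rintro ⟨z, hz, _, ⟨r, hr, rfl⟩, h⟩
        refine ⟨t - r, ?_, r, hr, by ring⟩
        rw [show (t - r) • v + (y : E) = z by
          rw [← sub_eq_zero] at h ⊢; rw [← neg_eq_zero, ← h]; module]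
        exact hz
      · rintro ⟨t', ht', r, hr, rfl⟩
        exact ⟨_, ht', _, ⟨r, hr, rfl⟩, by module⟩
    rw [h1]
    by_cases hy : y ∈ (ℝ ∙ v)ᗮ.orthogonalProjectionOnto '' V
    · rw [Set.indicator_of_mem hy]
      refine volume_add_Icc_of_convex ?_ ?_ ((mem_image_orthogonalProjectionOnto_iff hv).1 hy) hs
      · intro t ht r hr a b ha hb hab
        have := hV ht hr ha hb hab
        have e : a • (t • v + (y : E)) + b • (r • v + (y : E)) =
            (a • t + b • r) • v + (y : E) := by
          rw [smul_add, smul_add, add_add_add_comm, ← add_smul a b (y : E), hab, one_smul,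
            smul_smul, smul_smul, add_smul, smul_eq_mul, smul_eq_mul]
        rwa [e] at this
      · refine (hVk.image (f := fun z => ⟪v, z⟫_ℝ) (by fun_prop)).of_isClosed_subset
          (hVk.isClosed.preimage (by fun_prop)) ?_
        intro t ht
        refine ⟨_, ht, ?_⟩
        have h0 : ⟪v, (y : E)⟫_ℝ = 0 := Submodule.mem_orthogonal_singleton_iff_inner_right.1 y.2
        simp only [inner_add_right, inner_smul_right, real_inner_self_eq_norm_sq, hv, h0]
        simp
    · have h2 := hy
      rw [mem_image_orthogonalProjectionOnto_iff hv, Set.not_nonempty_iff_eq_empty] at h2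
      rw [Set.indicator_of_notMem hy, h2]
      simp
  rw [volume_eq_lintegral_volume_fiber hv hk.measurableSet,
    volume_eq_lintegral_volume_fiber hv hVk.measurableSet, lintegral_congr hfib,
    lintegral_add_right _ (measurable_const.indicator hPm), lintegral_indicator_const hPm]

end SegmentVolume

section ZonoidGeometry

variable {E : Type*} [NormedAddCommGroup E] [InnerProductSpace ℝ E]

/-- `Z` is a centrally symmetric zonoid with nonempty interior and support function `p`. -/
structure IsZonoidWithSupport (Z : Set E) (p : Seminorm ℝ E) : Prop where
  convex : Convex ℝ Z
  isCompact : IsCompact Z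
  zero_mem : (0 : E) ∈ Z
  isLUB : ∀ x, IsLUB ((fun z => ⟪z, x⟫_ℝ) '' Z) (p x)
  eq_zero : ∀ x, p x = 0 → x = 0
  approx : ∀ δ : ℝ, 0 < δ → ∃ (m : ℕ) (u : Fin m → E),
    Z ⊆ ∑ i, segment ℝ (-u i) (u i) ∧ ∑ i, segment ℝ (-u i) (u i) ⊆ (1 + δ) • Z

theorem mem_of_forall_inner_le [CompleteSpace E] {Z : Set E} (hZ : Convex ℝ Z)
    (hc : IsClosed Z) {p : E → ℝ}
    (hp : ∀ x, IsLUB ((fun z => ⟪z, x⟫_ℝ) '' Z) (p x)) {z : E} (hz : ∀ x, ⟪z, x⟫_ℝ ≤ p x) :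
    z ∈ Z := by
  by_contra hzZ
  obtain ⟨f, u, hf, hu⟩ := geometric_hahn_banach_closed_point hZ hc hzZ
  have e : ∀ a, f a = ⟪a, (InnerProductSpace.toDual ℝ E).symm f⟫_ℝ := fun a => by
    rw [real_inner_comm, InnerProductSpace.toDual_symm_apply]
  have h1 : p ((InnerProductSpace.toDual ℝ E).symm f) ≤ u := by
    refine (hp _).2 ?_
    rintro _ ⟨a, ha, rfl⟩
    simp only [← e]
    exact (hf a ha).le
  have h2 := hz ((InnerProductSpace.toDual ℝ E).symm f)
  rw [← e] at h2
  linarith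

theorem IsZonoidWithSupport.inner_le {Z : Set E} {p : Seminorm ℝ E}
    (h : IsZonoidWithSupport Z p) {z : E} (hz : z ∈ Z) (x : E) : ⟪z, x⟫_ℝ ≤ p x :=
  (h.isLUB x).1 ⟨z, hz, rfl⟩

theorem convex_sum_segment {ι : Type*} (s : Finset ι) (u : ι → E) :
    Convex ℝ (∑ i ∈ s, segment ℝ (-u i) (u i)) :=
  Finset.sum_induction _ (Convex ℝ) (fun _ _ => Convex.add) (convex_singleton (0 : E))
    fun _ _ => convex_segment _ _

theorem isCompact_segment (a b : E) : IsCompact (segment ℝ a b) := by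
  rw [segment_eq_image]
  exact isCompact_Icc.image (by fun_prop)

theorem isCompact_sum_segment {ι : Type*} (s : Finset ι) (u : ι → E) :
    IsCompact (∑ i ∈ s, segment ℝ (-u i) (u i)) :=
  Finset.sum_induction _ IsCompact (fun _ _ => IsCompact.add) isCompact_singleton
    fun _ _ => isCompact_segment _ _

theorem zero_mem_segment_neg_self (u : E) : (0 : E) ∈ segment ℝ (-u) u :=
  ⟨1 / 2, 1 / 2, by norm_num, by norm_num, by norm_num, by module⟩

theorem zero_mem_sum_segment {ι : Type*} (s : Finset ι) (u : ι → E) :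
    (0 : E) ∈ ∑ i ∈ s, segment ℝ (-u i) (u i) :=
  Finset.sum_induction _ (fun S : Set E => (0 : E) ∈ S)
    (fun _ _ hA hB => ⟨0, hA, 0, hB, add_zero 0⟩) (Set.mem_singleton 0)
    fun _ _ => zero_mem_segment_neg_self _

theorem abs_inner_le_of_mem_segment {u z x : E} (hz : z ∈ segment ℝ (-u) u) :
    |⟪z, x⟫_ℝ| ≤ |⟪u, x⟫_ℝ| := by
  obtain ⟨a, b, ha, hb, hab, rfl⟩ := hz
  rw [smul_neg, ← neg_smul, ← add_smul, real_inner_smul_left, abs_mul]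
  refine mul_le_of_le_one_left (abs_nonneg _) (abs_le.2 ⟨by linarith, by linarith⟩)

theorem inner_le_of_mem_sum_segment {ι : Type*} (s : Finset ι) (u : ι → E) {z : E}
    (hz : z ∈ ∑ i ∈ s, segment ℝ (-u i) (u i)) (x : E) :
    ⟪z, x⟫_ℝ ≤ ∑ i ∈ s, |⟪u i, x⟫_ℝ| := by
  classical
  induction s using Finset.induction_on generalizing z with
  | empty =>
    rw [Finset.sum_empty, Set.mem_zero] at hz
    simp [hz]
  | insert i s hi ih =>
    rw [Finset.sum_insert hi] at hz
    obtain ⟨a, ha, b, hb, rfl⟩ := hz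
    rw [inner_add_left, Finset.sum_insert hi]
    exact add_le_add ((le_abs_self _).trans (abs_inner_le_of_mem_segment ha)) (ih hb)

variable [FiniteDimensional ℝ E]

theorem IsZonoidWithSupport.exists_closedBall_subset {Z : Set E} {p : Seminorm ℝ E}
    (h : IsZonoidWithSupport Z p) : ∃ r : ℝ, 0 < r ∧ Metric.closedBall 0 r ⊆ Z := by
  obtain ⟨r, hr, hrp⟩ := p.exists_mul_norm_le h.eq_zero
  refine ⟨r, hr, fun z hz => mem_of_forall_inner_le h.convex h.isCompact.isClosed h.isLUB
    fun x => ?_⟩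
  rw [mem_closedBall_zero_iff] at hz
  refine (real_inner_le_norm z x).trans (le_trans ?_ (hrp x))
  gcongr

variable [MeasurableSpace E] [BorelSpace E]

theorem integrable_abs_inner_mul_exp (p : Seminorm ℝ E) (hp : ∀ x, p x = 0 → x = 0) (v : E) :
    Integrable fun x => |⟪v, x⟫_ℝ| * Real.exp (-p x) := by
  have hpc := p.continuous_of_finiteDimensional
  refine ⟨(Continuous.aestronglyMeasurable (by fun_prop)), ?_⟩
  rw [hasFiniteIntegral_iff_ofReal (Eventually.of_forall fun x => by positivity)]
  simp_rw [ENNReal.ofReal_mul (abs_nonneg _)]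
  exact (lintegral_abs_inner_mul_exp_ne_top p hp v).lt_top

/-- The first absolute moment of the density `exp (-p)` in the direction `v`, as a seminorm. -/
def momentSeminorm (p : Seminorm ℝ E) (hp : ∀ x, p x = 0 → x = 0) : Seminorm ℝ E :=
  Seminorm.of (fun v => ∫ x, |⟪v, x⟫_ℝ| * Real.exp (-p x))
    (fun v w => by
      rw [← integral_add (integrable_abs_inner_mul_exp p hp v)
        (integrable_abs_inner_mul_exp p hp w)]
      refine integral_mono (integrable_abs_inner_mul_exp p hp _)
        ((integrable_abs_inner_mul_exp p hp v).add (integrable_abs_inner_mul_exp p hp w))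
        fun x => ?_
      simp only [inner_add_left]
      rw [← add_mul]
      gcongr
      exact abs_add_le _ _)
    (fun c v => by
      rw [← integral_const_mul]
      refine integral_congr_ae (Eventually.of_forall fun x => ?_)
      simp only [real_inner_smul_left, abs_mul, Real.norm_eq_abs, mul_assoc])

theorem ofReal_momentSeminorm (p : Seminorm ℝ E) (hp : ∀ x, p x = 0 → x = 0) (v : E) :
    ENNReal.ofReal (momentSeminorm p hp v) =
      ∫⁻ x, ENNReal.ofReal |⟪v, x⟫_ℝ| * ENNReal.ofReal (Real.exp (-p x)) := by
  change ENNReal.ofReal (∫ x, |⟪v, x⟫_ℝ| * Real.exp (-p x)) = _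
  rw [ofReal_integral_eq_lintegral_ofReal (integrable_abs_inner_mul_exp p hp v)
    (Eventually.of_forall fun x => by positivity)]
  simp_rw [ENNReal.ofReal_mul (abs_nonneg _)]

theorem momentSeminorm_pos (p : Seminorm ℝ E) (hp : ∀ x, p x = 0 → x = 0) {v : E}
    (hv : ‖v‖ = 1) : 0 < momentSeminorm p hp v := by
  rw [← ENNReal.ofReal_pos, ofReal_momentSeminorm, lintegral_abs_inner_mul_exp_eq p hv,
    pos_iff_ne_zero]
  refine mul_ne_zero two_ne_zero ?_
  have hm := measurable_sectionIntegral p v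
  rw [Ne, lintegral_eq_zero_iff (by fun_prop), Filter.EventuallyEq,
    ae_restrict_iff' measurableSet_Ioi]
  intro h
  have h1 : volume (Set.Ioi (0 : ℝ)) = 0 := by
    refine measure_mono_null (fun t ht => ?_) (ae_iff.1 h)
    intro h2
    have h3 := h2 ht
    rw [Pi.zero_apply, mul_eq_zero, ENNReal.ofReal_eq_zero] at h3
    exact h3.elim (not_le.2 ht) (sectionIntegral_ne_zero p v t)
  simp at h1

theorem finrank_mul_expIntegral_le_sum {Z : Set E} {p : Seminorm ℝ E}
    (h : IsZonoidWithSupport Z p) {m : ℕ} {u : Fin m → E}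
    (hu : Z ⊆ ∑ i, segment ℝ (-u i) (u i)) :
    Module.finrank ℝ E * (expIntegral p).toReal ≤ ∑ i, momentSeminorm p h.eq_zero (u i) := by
  have h1 : ∀ x, p x ≤ ∑ i, |⟪u i, x⟫_ℝ| := fun x => by
    refine (h.isLUB x).2 ?_
    rintro _ ⟨z, hz, rfl⟩
    exact inner_le_of_mem_sum_segment _ _ (hu hz) x
  have h2 : Module.finrank ℝ E * expIntegral p ≤
      ENNReal.ofReal (∑ i, momentSeminorm p h.eq_zero (u i)) := by
    refine (finrank_mul_expIntegral_le p h.eq_zero).trans ?_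
    rw [ENNReal.ofReal_sum_of_nonneg fun i _ => apply_nonneg _ _]
    simp_rw [ofReal_momentSeminorm]
    have hm := p.measurable_exp_neg
    rw [← lintegral_finsetSum _ fun i _ => by fun_prop]
    refine lintegral_mono fun x => ?_
    rw [← Finset.sum_mul, ← ENNReal.ofReal_sum_of_nonneg fun i _ => abs_nonneg _]
    gcongr
    exact h1 x
  have h3 := ENNReal.toReal_mono ENNReal.ofReal_ne_top h2
  rwa [ENNReal.toReal_mul, ENNReal.toReal_natCast,
    ENNReal.toReal_ofReal (Finset.sum_nonneg fun i _ => apply_nonneg _ _)] at h3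

end ZonoidGeometry

section KeyInequality

variable {E : Type*} [NormedAddCommGroup E] [InnerProductSpace ℝ E] [FiniteDimensional ℝ E]
  [MeasurableSpace E] [BorelSpace E]

theorem volume_add_segment_neg {V : Set E} (hV : Convex ℝ V) (hVk : IsCompact V) {v : E}
    (hv : ‖v‖ = 1) {s : ℝ} (hs : 0 ≤ s) :
    volume (V + segment ℝ (-(s • v)) (s • v)) =
      volume V + ENNReal.ofReal (2 * s) * volume ((ℝ ∙ v)ᗮ.orthogonalProjectionOnto '' V) := by
  rw [← volume_add_segment hV hVk hv (by positivity)]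
  have h1 : segment ℝ (-(s • v)) (s • v) = (fun x => -(s • v) + x) '' segment ℝ 0 ((2 * s) • v) := by
    rw [segment_translate_image]
    congr 1
    · simp
    · module
  rw [h1, Set.image_add_left]
  have h2 : V + (fun x => - -(s • v) + x) ⁻¹' segment ℝ 0 ((2 * s) • v) =
      (fun x => - -(s • v) + x) ⁻¹' (V + segment ℝ 0 ((2 * s) • v)) := by
    rw [← Set.image_add_left, ← Set.image_add_left, ← Set.singleton_add, ← Set.singleton_add,
      add_left_comm]
  rw [h2, measure_preimage_add]

theorem volume_add_sum_segment_ge {Z : Set E} (hZ : Convex ℝ Z) (hZk : IsCompact Z)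
    (q : Seminorm ℝ E) {l : ℝ} (hl : 0 ≤ l)
    (hq : ∀ v : E, ‖v‖ = 1 → ENNReal.ofReal (l * q v) ≤
      volume ((ℝ ∙ v)ᗮ.orthogonalProjectionOnto '' Z))
    {ι : Type*} (s : Finset ι) (u : ι → E) :
    volume Z + ENNReal.ofReal (2 * l * ∑ i ∈ s, q (u i)) ≤
      volume (Z + ∑ i ∈ s, segment ℝ (-u i) (u i)) := by
  classical
  induction s using Finset.induction_on with
  | empty => simp
  | insert i s hi ih =>
    set V := Z + ∑ i ∈ s, segment ℝ (-u i) (u i) with hVdef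
    have hV : Convex ℝ V := hZ.add (convex_sum_segment s u)
    have hVk : IsCompact V := hZk.add (isCompact_sum_segment s u)
    have hZV : Z ⊆ V := fun z hz => ⟨z, hz, 0, zero_mem_sum_segment s u, add_zero z⟩
    have hsum : Z + ∑ i ∈ insert i s, segment ℝ (-u i) (u i) =
        V + segment ℝ (-u i) (u i) := by
      rw [Finset.sum_insert hi, hVdef, add_assoc, add_comm (segment ℝ _ _)]
    rw [hsum, Finset.sum_insert hi, add_comm (q (u i)), mul_add, ENNReal.ofReal_add
      (mul_nonneg (by positivity) (Finset.sum_nonneg fun i _ => apply_nonneg _ _))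
      (mul_nonneg (by positivity) (apply_nonneg _ _)), ← add_assoc]
    rcases eq_or_ne (u i) 0 with h0 | h0
    · simpa [h0] using ih
    · have hs : 0 < ‖u i‖ := norm_pos_iff.2 h0
      obtain ⟨v, hv, hvu⟩ : ∃ v : E, ‖v‖ = 1 ∧ u i = ‖u i‖ • v :=
        ⟨‖u i‖⁻¹ • u i, by rw [norm_smul, norm_inv, norm_norm, inv_mul_cancel₀ hs.ne'],
          by rw [smul_inv_smul₀ hs.ne']⟩
      have h3 := volume_add_segment_neg hV hVk hv hs.le
      rw [← hvu] at h3
      rw [h3]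
      refine add_le_add ih ?_
      have h4 : q (u i) = ‖u i‖ * q v := by
        conv_lhs => rw [hvu]
        rw [map_smul_eq_mul, norm_norm]
      rw [h4, show 2 * l * (‖u i‖ * q v) = 2 * ‖u i‖ * (l * q v) by ring,
        ENNReal.ofReal_mul (by positivity)]
      gcongr
      exact (hq v hv).trans (measure_mono (Set.image_mono hZV))

theorem volume_real_smul {r : ℝ} (hr : 0 ≤ r) (S : Set E) :
    volume.real (r • S) = r ^ Module.finrank ℝ E * volume.real S := by
  rw [measureReal_def, Measure.addHaar_smul_of_nonneg _ hr, ENNReal.toReal_mul,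
    ENNReal.toReal_ofReal (by positivity), measureReal_def]

theorem two_mul_sum_le_of_sum_segment_subset {Z : Set E} (hZ : Convex ℝ Z) (hZk : IsCompact Z)
    (q : Seminorm ℝ E) {l : ℝ} (hl : 0 ≤ l)
    (hq : ∀ v : E, ‖v‖ = 1 → ENNReal.ofReal (l * q v) ≤
      volume ((ℝ ∙ v)ᗮ.orthogonalProjectionOnto '' Z))
    {m : ℕ} (u : Fin m → E) {K : ℝ} (hK : 0 ≤ K)
    (hu : ∑ i, segment ℝ (-u i) (u i) ⊆ K • Z) :
    2 * l * ∑ i, q (u i) ≤ Module.finrank ℝ E * K * volume.real Z := by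
  have hZt : volume Z ≠ ∞ := hZk.measure_lt_top.ne
  have h1 : ∀ ε : ℝ, 0 < ε → 2 * l * ∑ i, q (u i) ≤
      ε⁻¹ * ((1 + ε * K) ^ Module.finrank ℝ E - 1) * volume.real Z := by
    intro ε hε
    have h2 := volume_add_sum_segment_ge hZ hZk q hl hq Finset.univ fun i => ε • u i
    have h3 : Z + ∑ i, segment ℝ (-(ε • u i)) (ε • u i) ⊆ (1 + ε * K) • Z := by
      rw [hZ.add_smul zero_le_one (by positivity), one_smul, mul_smul]
      gcongr
      have : ∀ i, segment ℝ (-(ε • u i)) (ε • u i) = ε • segment ℝ (-u i) (u i) := fun i => by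
        have := image_segment ℝ (LinearMap.lsmul ℝ E ε).toAffineMap (-u i) (u i)
        rw [← smul_neg]
        exact this.symm
      simp_rw [this]
      rw [← Finset.smul_sum]
      exact Set.smul_set_mono hu
    have h4 := h2.trans (measure_mono h3)
    have hKZ : volume ((1 + ε * K) • Z) ≠ ∞ := (hZk.smul _).measure_lt_top.ne
    have h0 : 0 ≤ ∑ i, q (u i) := Finset.sum_nonneg fun i _ => apply_nonneg _ _
    simp_rw [map_smul_eq_mul, Real.norm_of_nonneg hε.le] at h4
    rw [← Finset.mul_sum] at h4
    have h5 := ENNReal.toReal_mono hKZ h4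
    rw [ENNReal.toReal_add hZt ENNReal.ofReal_ne_top, ENNReal.toReal_ofReal (by positivity),
      ← measureReal_def, ← measureReal_def, volume_real_smul (by positivity)] at h5
    rw [← div_eq_inv_mul, div_mul_eq_mul_div, le_div_iff₀ hε]
    linarith
  have h6 : HasDerivAt (fun ε : ℝ => (1 + ε * K) ^ Module.finrank ℝ E)
      (Module.finrank ℝ E * K) 0 := by
    have := (((hasDerivAt_id (0 : ℝ)).mul_const K).const_add 1).pow (Module.finrank ℝ E)
    simpa [Pi.pow_def] using this
  have h7 := (h6.tendsto_slope_zero_right).mul_const (volume.real Z)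
  refine ge_of_tendsto h7 ?_
  filter_upwards [self_mem_nhdsWithin] with ε hε
  simpa using h1 ε hε

theorem continuous_volume_add_segment {Z : Set E} (hZ : Convex ℝ Z) (hZk : IsCompact Z)
    {r : ℝ} (hr : 0 < r) (hZr : Metric.closedBall 0 r ⊆ Z) :
    Continuous fun u : E => volume.real (Z + segment ℝ 0 u) := by
  set N := Module.finrank ℝ E
  have hle : ∀ u w : E, volume.real (Z + segment ℝ 0 w) ≤
      (1 + ‖w - u‖ / r) ^ N * volume.real (Z + segment ℝ 0 u) := by
    intro u w
    rw [← volume_real_smul (by positivity)]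
    refine measureReal_mono ?_ ((hZk.add (isCompact_segment _ _)).smul _).measure_lt_top.ne
    set η := ‖w - u‖ / r with hη
    have hη0 : 0 ≤ η := by positivity
    rintro _ ⟨z, hz, y, hy, rfl⟩
    rw [segment_eq_image] at hy
    obtain ⟨θ, hθ, rfl⟩ := hy
    rw [smul_add, hZ.add_smul zero_le_one hη0, one_smul]
    have h1 : θ • (w - u) ∈ η • Z := by
      refine Set.smul_set_mono hZr ?_
      rw [smul_closedBall _ _ hr.le, smul_zero, mem_closedBall_zero_iff, Real.norm_of_nonneg hη0,
        hη, div_mul_cancel₀ _ hr.ne', norm_smul, Real.norm_of_nonneg hθ.1]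
      exact mul_le_of_le_one_left (norm_nonneg _) hθ.2
    have h2 : θ • u ∈ (1 + η) • segment ℝ 0 u := by
      refine ⟨(θ / (1 + η)) • u, ?_, ?_⟩
      · rw [segment_eq_image]
        refine ⟨θ / (1 + η), ⟨div_nonneg hθ.1 (by positivity), ?_⟩, by simp⟩
        rw [div_le_one (by positivity)]
        linarith [hθ.2]
      · simp only [smul_smul]
        rw [mul_div_cancel₀ _ (by positivity)]
    refine ⟨_, ⟨z, hz, _, h1, rfl⟩, _, h2, ?_⟩
    simp only
    module
  rw [continuous_iff_continuousAt]
  intro u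
  have hc1 : Tendsto (fun w => (1 + ‖w - u‖ / r) ^ N * volume.real (Z + segment ℝ 0 u)) (𝓝 u)
      (𝓝 (volume.real (Z + segment ℝ 0 u))) := by
    have : Continuous fun w => (1 + ‖w - u‖ / r) ^ N * volume.real (Z + segment ℝ 0 u) := by
      fun_prop
    simpa using this.tendsto u
  have hc2 : Tendsto (fun w => ((1 + ‖w - u‖ / r) ^ N)⁻¹ * volume.real (Z + segment ℝ 0 u)) (𝓝 u)
      (𝓝 (volume.real (Z + segment ℝ 0 u))) := by
    have : Continuous fun w =>
        ((1 + ‖w - u‖ / r) ^ N)⁻¹ * volume.real (Z + segment ℝ 0 u) := by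
      refine Continuous.mul (Continuous.inv₀ (by fun_prop) fun w => ?_) continuous_const
      positivity
    simpa using this.tendsto u
  refine tendsto_of_tendsto_of_tendsto_of_le_of_le hc2 hc1 (fun w => ?_) fun w => hle u w
  rw [← div_eq_inv_mul, div_le_iff₀ (by positivity), mul_comm, norm_sub_rev]
  exact hle w u

theorem IsZonoidWithSupport.exists_two_mul_le [Nontrivial E] {Z : Set E} {p : Seminorm ℝ E}
    (h : IsZonoidWithSupport Z p) :
    ∃ v : E, ‖v‖ = 1 ∧
      2 * (volume ((ℝ ∙ v)ᗮ.orthogonalProjectionOnto '' Z) * expIntegral p) ≤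
        volume Z *
          ∫⁻ x, ENNReal.ofReal |⟪v, x⟫_ℝ| * ENNReal.ofReal (Real.exp (-p x)) := by
  obtain ⟨r, hr, hZr⟩ := h.exists_closedBall_subset
  set b := momentSeminorm p h.eq_zero with hb
  set a : E → ℝ := fun u => volume.real (Z + segment ℝ 0 u) - volume.real Z with ha
  have hZt : volume Z ≠ ∞ := h.isCompact.measure_lt_top.ne
  have hPt : ∀ v : E, volume ((ℝ ∙ v)ᗮ.orthogonalProjectionOnto '' Z) ≠ ∞ := fun v =>
    (h.isCompact.image (ContinuousLinearMap.continuous _)).measure_lt_top.ne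
  have hav : ∀ v : E, ‖v‖ = 1 → a v =
      (volume ((ℝ ∙ v)ᗮ.orthogonalProjectionOnto '' Z)).toReal := by
    intro v hv
    have h1 := volume_add_segment h.convex h.isCompact hv zero_le_one
    rw [one_smul, ENNReal.ofReal_one, one_mul] at h1
    rw [ha]
    simp only
    rw [measureReal_def, h1, ENNReal.toReal_add hZt (hPt v), measureReal_def]
    ring
  have hbpos : ∀ v : E, ‖v‖ = 1 → 0 < b v := fun v hv => momentSeminorm_pos p h.eq_zero hv
  have hac : Continuous a :=
    (continuous_volume_add_segment h.convex h.isCompact hr hZr).sub continuous_const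
  obtain ⟨v, hv, hmin⟩ := (isCompact_sphere (0 : E) 1).exists_isMinOn
    (NormedSpace.sphere_nonempty.2 zero_le_one) (f := fun v => a v / b v)
    (ContinuousOn.div hac.continuousOn b.continuous_of_finiteDimensional.continuousOn
      fun v hv => (hbpos v (mem_sphere_zero_iff_norm.1 hv)).ne')
  rw [mem_sphere_zero_iff_norm] at hv
  refine ⟨v, hv, ?_⟩
  set l := a v / b v with hl
  have hl0 : 0 ≤ l := by
    rw [hl, hav v hv]
    exact div_nonneg ENNReal.toReal_nonneg (hbpos v hv).le
  have hq : ∀ w : E, ‖w‖ = 1 → ENNReal.ofReal (l * b w) ≤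
      volume ((ℝ ∙ w)ᗮ.orthogonalProjectionOnto '' Z) := by
    intro w hw
    have h2 : l ≤ a w / b w := hmin (mem_sphere_zero_iff_norm.2 hw)
    rw [le_div_iff₀ (hbpos w hw), hav w hw] at h2
    exact ENNReal.ofReal_le_of_le_toReal h2
  have hN : (0 : ℝ) < Module.finrank ℝ E := by exact_mod_cast Module.finrank_pos
  have h3 : ∀ δ : ℝ, 0 < δ → 2 * l * (expIntegral p).toReal ≤ (1 + δ) * volume.real Z := by
    intro δ hδ
    obtain ⟨m, u, hu1, hu2⟩ := h.approx δ hδ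
    have h4 := two_mul_sum_le_of_sum_segment_subset h.convex h.isCompact b hl0 hq u
      (by positivity) hu2
    have h5 := mul_le_mul_of_nonneg_left (finrank_mul_expIntegral_le_sum h hu1)
      (by positivity : 0 ≤ 2 * l)
    refine le_of_mul_le_mul_left ?_ hN
    linarith
  have h6 : 2 * l * (expIntegral p).toReal ≤ volume.real Z := by
    have h7 : Tendsto (fun δ : ℝ => (1 + δ) * volume.real Z) (𝓝[>] 0)
        (𝓝 (volume.real Z)) := by
      have : Continuous fun δ : ℝ => (1 + δ) * volume.real Z := by fun_prop
      have := (this.tendsto 0).mono_left (nhdsWithin_le_nhds (s := Set.Ioi 0))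
      simpa using this
    refine ge_of_tendsto h7 ?_
    filter_upwards [self_mem_nhdsWithin] with δ hδ using h3 δ hδ
  have hIt := expIntegral_ne_top p h.eq_zero
  rw [← ofReal_momentSeminorm p h.eq_zero, ← hb]
  rw [← ENNReal.toReal_le_toReal (by finiteness [hPt v]) (by finiteness), ENNReal.toReal_mul,
    ENNReal.toReal_mul, ENNReal.toReal_mul, ENNReal.toReal_ofReal (apply_nonneg _ _),
    ← hav v hv, ← measureReal_def, ENNReal.toReal_ofNat]
  have h8 : a v = l * b v := by rw [hl, div_mul_cancel₀ _ (hbpos v hv).ne']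
  rw [h8]
  have := mul_le_mul_of_nonneg_right h6 (hbpos v hv).le
  linarith

end KeyInequality

section Induction

theorem IsZonoidWithSupport.orthogonalProjectionOnto {E : Type*} [NormedAddCommGroup E]
    [InnerProductSpace ℝ E] {Z : Set E} {p : Seminorm ℝ E} (h : IsZonoidWithSupport Z p)
    (K : Submodule ℝ E) [K.HasOrthogonalProjection] :
    IsZonoidWithSupport (K.orthogonalProjectionOnto '' Z) (p.comp K.subtype) where
  convex := h.convex.linear_image K.orthogonalProjectionOnto.toLinearMap
  isCompact := h.isCompact.image K.orthogonalProjectionOnto.continuous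
  zero_mem := ⟨0, h.zero_mem, map_zero _⟩
  isLUB x := by
    rw [Set.image_image]
    simp only [Submodule.inner_orthogonalProjectionOnto_eq_of_mem_right]
    exact h.isLUB x
  eq_zero x hx := Subtype.ext (h.eq_zero _ hx)
  approx δ hδ := by
    obtain ⟨m, u, hu1, hu2⟩ := h.approx δ hδ
    have e : K.orthogonalProjectionOnto '' (∑ i, segment ℝ (-u i) (u i)) =
        ∑ i, segment ℝ (-K.orthogonalProjectionOnto (u i)) (K.orthogonalProjectionOnto (u i)) := by
      rw [Set.image_finsetSum]
      refine Finset.sum_congr rfl fun i _ => ?_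
      rw [← map_neg]
      exact image_segment ℝ K.orthogonalProjectionOnto.toLinearMap.toAffineMap _ _
    refine ⟨m, fun i => K.orthogonalProjectionOnto (u i), ?_, ?_⟩
    · rw [← e]
      exact Set.image_mono hu1
    · rw [← e, ← image_smul_set]
      exact Set.image_mono hu2

theorem Seminorm.exists_eq_sum_abs_inner {E : Type*} [NormedAddCommGroup E]
    [InnerProductSpace ℝ E] (p : Seminorm ℝ E) {v : E} (hv : ‖v‖ = 1)
    {c : ℝ} {y₀ : (ℝ ∙ v)ᗮ}
    (hp : ∀ (t : ℝ) (y : (ℝ ∙ v)ᗮ),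
      p (t • v + y) = |t| * c + p ((y - t • y₀ : (ℝ ∙ v)ᗮ) : E))
    {n : ℕ} {d : Fin n → (ℝ ∙ v)ᗮ} (hd : ∀ y : (ℝ ∙ v)ᗮ, p y = ∑ j, |⟪d j, y⟫_ℝ|) :
    ∃ u : Fin (n + 1) → E, ∀ x, p x = ∑ j, |⟪u j, x⟫_ℝ| := by
  have hc : 0 ≤ c := by
    have := hp 1 y₀
    simp only [one_smul, abs_one, one_mul, sub_self, ZeroMemClass.coe_zero, map_zero,
      add_zero] at this
    rw [← this]
    exact apply_nonneg _ _
  refine ⟨Fin.cons (c • v) fun j => (d j : E) - ⟪d j, y₀⟫_ℝ • v, fun x => ?_⟩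
  have hx := (ℝ ∙ v).starProjection_add_starProjection_orthogonal x
  rw [Submodule.starProjection_unit_singleton ℝ hv,
    ← Submodule.coe_orthogonalProjectionOnto_apply] at hx
  conv_lhs => rw [← hx]
  rw [hp, hd, Fin.sum_univ_succ]
  congr 1
  · rw [Fin.cons_zero, real_inner_smul_left, abs_mul, abs_of_nonneg hc, mul_comm]
  · refine Finset.sum_congr rfl fun j _ => ?_
    rw [Fin.cons_succ, inner_sub_right, inner_sub_left, inner_smul_right, real_inner_smul_left,
      Submodule.inner_orthogonalProjectionOnto_eq_of_mem_left, mul_comm]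

theorem four_mul_le_of_two_mul_le {V I b J W A : ℝ≥0∞} (hb0 : b ≠ 0) (hbt : b ≠ ∞) (hJ0 : J ≠ 0)
    (hJt : J ≠ ∞) (h1 : 2 * (W * I) ≤ V * b) (h2 : 2 * (J * b) ≤ I ^ 2) (h3 : A ≤ W * J) :
    4 * A ≤ V * I := by
  rw [← ENNReal.mul_le_mul_iff_left (mul_ne_zero hJ0 hb0) (ENNReal.mul_ne_top hJt hbt)]
  calc 4 * A * (J * b) = 2 * A * (2 * (J * b)) := by ring
    _ ≤ 2 * (W * J) * I ^ 2 := by gcongr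
    _ = 2 * (W * I) * (J * I) := by ring
    _ ≤ V * b * (J * I) := by gcongr
    _ = V * I * (J * b) := by ring

theorem eq_and_le_of_two_mul_le {V I b J W A : ℝ≥0∞} (hA0 : A ≠ 0) (hAt : A ≠ ∞)
    (hI0 : I ≠ 0) (hIt : I ≠ ∞) (h1 : 2 * (W * I) ≤ V * b) (h2 : 2 * (J * b) ≤ I ^ 2)
    (h3 : A ≤ W * J) (h : V * I = 4 * A) : W * J = A ∧ I ^ 2 ≤ 2 * (J * b) := by
  have h4 : 2 * I ^ 2 * (W * J) ≤ 2 * A * (2 * (J * b)) :=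
    calc 2 * I ^ 2 * (W * J) = 2 * (W * I) * (J * I) := by ring
      _ ≤ V * b * (J * I) := by gcongr
      _ = V * I * (J * b) := by ring
      _ = 2 * A * (2 * (J * b)) := by rw [h]; ring
  constructor
  · refine le_antisymm ?_ h3
    rw [← ENNReal.mul_le_mul_iff_right (a := 2 * I ^ 2) (by simp [hI0]) (by finiteness)]
    calc _ ≤ _ := h4
      _ ≤ 2 * A * I ^ 2 := by gcongr
      _ = _ := by ring
  · rw [← ENNReal.mul_le_mul_iff_right (a := 2 * A) (by simp [hA0]) (by finiteness)]
    calc 2 * A * I ^ 2 = 2 * I ^ 2 * A := by ring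
      _ ≤ 2 * I ^ 2 * (W * J) := by gcongr
      _ ≤ _ := h4

theorem volume_univ_of_subsingleton (E : Type*) [NormedAddCommGroup E] [InnerProductSpace ℝ E]
    [FiniteDimensional ℝ E] [MeasurableSpace E] [BorelSpace E] [Subsingleton E] :
    volume (Set.univ : Set E) = 1 := by
  rw [← (stdOrthonormalBasis ℝ E).volume_parallelepiped]
  congr 1
  exact (Subsingleton.eq_univ_of_nonempty ⟨0, by
    rw [mem_parallelepiped_iff]
    exact ⟨0, by simp, Subsingleton.elim _ _⟩⟩).symm

theorem IsZonoidWithSupport.four_pow_le_and {E : Type*} [NormedAddCommGroup E]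
    [InnerProductSpace ℝ E] [FiniteDimensional ℝ E] [MeasurableSpace E] [BorelSpace E]
    {Z : Set E} {p : Seminorm ℝ E} (h : IsZonoidWithSupport Z p) {n : ℕ}
    (hn : Module.finrank ℝ E = n) :
    4 ^ n ≤ volume Z * expIntegral p ∧ (volume Z * expIntegral p = 4 ^ n →
      ∃ u : Fin n → E, ∀ x, p x = ∑ j, |⟪u j, x⟫_ℝ|) := by
  induction n generalizing E with
  | zero =>
    have := Module.finrank_zero_iff.1 hn
    have hZ : Z = Set.univ := Subsingleton.eq_univ_of_nonempty ⟨0, h.zero_mem⟩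
    have hp : ∀ x, p x = 0 := fun x => by rw [Subsingleton.elim x 0, map_zero]
    constructor
    · rw [hZ, volume_univ_of_subsingleton, expIntegral]
      simp [hp, volume_univ_of_subsingleton]
    · exact fun _ => ⟨Fin.elim0, fun x => by simp [hp]⟩
  | succ n ih =>
    have hnt : Nontrivial E := Module.nontrivial_of_finrank_pos (R := ℝ) (by omega)
    obtain ⟨v, hv, h1⟩ := h.exists_two_mul_le
    have : Fact (Module.finrank ℝ E = n + 1) := ⟨hn⟩
    have hfr : Module.finrank ℝ (ℝ ∙ v)ᗮ = n :=
      Submodule.finrank_orthogonal_span_singleton (by rintro rfl; simp at hv)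
    have hP := h.orthogonalProjectionOnto (ℝ ∙ v)ᗮ
    obtain ⟨h3, h3'⟩ := ih hP hfr
    have h2 := two_mul_expIntegral_section_mul_le p hv
    have hb0 : ∫⁻ x, ENNReal.ofReal |⟪v, x⟫_ℝ| * ENNReal.ofReal (Real.exp (-p x)) ≠ 0 := by
      rw [← ofReal_momentSeminorm p h.eq_zero]
      exact (ENNReal.ofReal_pos.2 (momentSeminorm_pos p h.eq_zero hv)).ne'
    have hbt := lintegral_abs_inner_mul_exp_ne_top p h.eq_zero v
    refine ⟨?_, fun heq => ?_⟩
    · rw [pow_succ']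
      exact four_mul_le_of_two_mul_le hb0 hbt (expIntegral_ne_zero _)
        (expIntegral_ne_top _ hP.eq_zero) h1 h2 h3
    · rw [pow_succ'] at heq
      obtain ⟨h4, h5⟩ := eq_and_le_of_two_mul_le (by simp) (by finiteness)
        (expIntegral_ne_zero _) (expIntegral_ne_top _ h.eq_zero) h1 h2 h3 heq
      obtain ⟨d, hd⟩ := h3' h4
      obtain ⟨c, y₀, hc⟩ := p.exists_smul_add_eq h.eq_zero hv h5
      exact p.exists_eq_sum_abs_inner hv hc hd

end Induction

theorem sum_segment_mem_neg {E ι : Type*} [NormedAddCommGroup E] [InnerProductSpace ℝ E]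
    (s : Finset ι) (u : ι → E) {z : E} (hz : z ∈ ∑ i ∈ s, segment ℝ (-u i) (u i)) :
    -z ∈ ∑ i ∈ s, segment ℝ (-u i) (u i) := by
  have : -(∑ i ∈ s, segment ℝ (-u i) (u i)) = ∑ i ∈ s, segment ℝ (-u i) (u i) := by
    rw [← Set.image_neg_eq_neg]
    refine (Set.image_finsetSum (-AddMonoidHom.id E) s _).trans ?_
    refine Finset.sum_congr rfl fun i _ => ?_
    have := image_segment ℝ (-LinearMap.id (R := ℝ) (M := E)).toAffineMap (-u i) (u i)
    refine this.trans ?_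
    simp [segment_symm]
  rw [← this]
  simpa using hz

theorem sum_segment_eq_singleton_add {E ι : Type*} [NormedAddCommGroup E] [InnerProductSpace ℝ E]
    (s : Finset ι) (a b : ι → E) :
    ∑ i ∈ s, segment ℝ (a i) (b i) = {∑ i ∈ s, (2⁻¹ : ℝ) • (a i + b i)} +
      ∑ i ∈ s, segment ℝ (-((2⁻¹ : ℝ) • (b i - a i))) ((2⁻¹ : ℝ) • (b i - a i)) := by
  classical
  induction s using Finset.induction_on with
  | empty => simp [Set.singleton_zero]
  | insert i s hi ih =>
    rw [Finset.sum_insert hi, Finset.sum_insert hi, Finset.sum_insert hi, ih,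
      ← Set.singleton_add_singleton]
    have : segment ℝ (a i) (b i) = {(2⁻¹ : ℝ) • (a i + b i)} +
        segment ℝ (-((2⁻¹ : ℝ) • (b i - a i))) ((2⁻¹ : ℝ) • (b i - a i)) := by
      rw [Set.singleton_add, segment_translate_image]
      congr 1 <;> module
    rw [this]
    exact add_add_add_comm _ _ _ _

section EuclideanSpace

variable {n : ℕ}

theorem mem_sum_segment_single {ε : ℝ} {z : EuclideanSpace ℝ (Fin n)} (hz : ‖z‖ ≤ ε) :
    z ∈ ∑ j : Fin n, segment ℝ (-EuclideanSpace.single j ε) (EuclideanSpace.single j ε) := by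
  have hz' : z = ∑ j, EuclideanSpace.single j (z j) := by
    ext i
    simp [Pi.single_apply]
  rw [hz']
  refine Set.finsetSum_mem_finsetSum _ _ _ fun j _ => ?_
  have hj : |z j| ≤ ε := (PiLp.norm_apply_le z j).trans hz
  have := image_segment ℝ (LinearMap.toSpanSingleton ℝ _
    (EuclideanSpace.single j (1 : ℝ))).toAffineMap (-ε) ε
  have e : ∀ t : ℝ, t • EuclideanSpace.single j (1 : ℝ) = EuclideanSpace.single j t := fun t => by
    ext i
    simp
  simp only [LinearMap.coe_toAffineMap, LinearMap.toSpanSingleton_apply, e] at this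
  rw [← PiLp.single_neg, ← this, segment_eq_Icc (by linarith [abs_nonneg (z j)])]
  exact ⟨z j, abs_le.1 hj, by simp⟩

theorem norm_le_of_mem_sum_segment_single {ε : ℝ} (hε : 0 ≤ ε) {z : EuclideanSpace ℝ (Fin n)}
    (hz : z ∈ ∑ j : Fin n, segment ℝ (-EuclideanSpace.single j ε) (EuclideanSpace.single j ε)) :
    ‖z‖ ≤ n * ε := by
  obtain ⟨g, hg, rfl⟩ := (Set.mem_finsetSum _ _ _).1 hz
  refine (norm_sum_le _ _).trans ?_
  calc ∑ j, ‖g j‖ ≤ ∑ _j : Fin n, ε := by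
        refine Finset.sum_le_sum fun j _ => ?_
        have := (convex_closedBall (0 : EuclideanSpace ℝ (Fin n)) ε).segment_subset
          (by simp [abs_of_nonneg hε]) (by simp [abs_of_nonneg hε]) (hg (Finset.mem_univ j))
        simpa using this
    _ = n * ε := by simp

theorem IsZonoid.exists_sum_segment {Z : Set (EuclideanSpace ℝ (Fin n))} (hZ : IsZonoid Z)
    (hsym : Z = -Z) {r : ℝ} (hr : 0 < r)
    (hball : Metric.closedBall 0 r ⊆ Z) {δ : ℝ} (hδ : 0 < δ) :
    ∃ (m : ℕ) (u : Fin m → EuclideanSpace ℝ (Fin n)),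
      Z ⊆ ∑ i, segment ℝ (-u i) (u i) ∧ ∑ i, segment ℝ (-u i) (u i) ⊆ (1 + δ) • Z := by
  obtain ⟨⟨hconv, hcomp, hint⟩, W, hW, hlim⟩ := hZ
  have hneg : ∀ z ∈ Z, -z ∈ Z := fun z hz => by rw [hsym] at hz; exact hz
  set ε : ℝ := δ * r / (n + 1) with hε
  have hε0 : 0 < ε := by positivity
  obtain ⟨k, hk⟩ := (hlim.eventually (gt_mem_nhds hε0)).exists
  obtain ⟨m, a, b, hWk⟩ := hW k
  rw [sum_segment_eq_singleton_add] at hWk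
  set h : Fin m → EuclideanSpace ℝ (Fin n) := fun i => (2⁻¹ : ℝ) • (b i - a i) with hh
  set c := ∑ i, (2⁻¹ : ℝ) • (a i + b i) with hc
  have hfin : Metric.hausdorffEDist (W k) Z ≠ ⊤ := by
    refine Metric.hausdorffEDist_ne_top_of_nonempty_of_bounded ?_
      (hint.mono interior_subset) ?_ hcomp.isBounded
    · rw [hWk]
      exact (Set.singleton_nonempty _).add ⟨0, zero_mem_sum_segment _ _⟩
    · rw [hWk]
      exact (isCompact_singleton.add (isCompact_sum_segment _ _)).isBounded
  have h1 : ∀ s ∈ ∑ i, segment ℝ (-h i) (h i), ∃ z ∈ Z, ‖c + s - z‖ ≤ ε := fun s hs => by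
    have : c + s ∈ W k := by
      rw [hWk]
      exact Set.add_mem_add rfl hs
    obtain ⟨z, hz, hd⟩ := Metric.exists_dist_lt_of_hausdorffDist_lt this hk hfin
    exact ⟨z, hz, by rw [← dist_eq_norm]; exact hd.le⟩
  have h2 : ∀ z ∈ Z, ∃ s ∈ ∑ i, segment ℝ (-h i) (h i), ‖c + s - z‖ ≤ ε := fun z hz => by
    obtain ⟨w, hw, hd⟩ := Metric.exists_dist_lt_of_hausdorffDist_lt' hz hk hfin
    rw [hWk] at hw
    obtain ⟨_, rfl, s, hs, rfl⟩ := hw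
    exact ⟨s, hs, by rw [← dist_eq_norm]; exact hd.le⟩
  have half : ∀ e e' : EuclideanSpace ℝ (Fin n), ‖e‖ ≤ ε → ‖e'‖ ≤ ε →
      ‖(2⁻¹ : ℝ) • (e - e')‖ ≤ ε := fun e e' he he' => by
    rw [norm_smul, Real.norm_of_nonneg (by norm_num)]
    linarith [norm_sub_le e e']
  refine ⟨m + n, Fin.append h fun j => EuclideanSpace.single j ε, ?_⟩
  rw [Fin.sum_univ_add]
  simp only [Fin.append_left, Fin.append_right]
  constructor
  · intro z hz
    obtain ⟨s, hs, hd⟩ := h2 z hz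
    obtain ⟨s', hs', hd'⟩ := h2 (-z) (hneg z hz)
    refine ⟨(2⁻¹ : ℝ) • s + (2⁻¹ : ℝ) • (-s'),
      convex_sum_segment _ _ hs (sum_segment_mem_neg _ _ hs')
        (by norm_num) (by norm_num) (by norm_num),
      _, mem_sum_segment_single (half _ _ hd' hd), ?_⟩
    module
  · rintro _ ⟨s, hs, q, hq, rfl⟩
    obtain ⟨z, hz, hd⟩ := h1 s hs
    obtain ⟨z', hz', hd'⟩ := h1 (-s) (sum_segment_mem_neg _ _ hs)
    have hq' := norm_le_of_mem_sum_segment_single hε0.le hq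
    rw [hconv.add_smul zero_le_one hδ.le, one_smul]
    set e := (2⁻¹ : ℝ) • ((c + s - z) - (c + -s - z')) + q with he
    have hen : ‖e‖ ≤ δ * r := by
      refine (norm_add_le _ _).trans ((add_le_add (half _ _ hd hd') hq').trans_eq ?_)
      rw [hε]
      field_simp
      ring
    refine ⟨(2⁻¹ : ℝ) • z + (2⁻¹ : ℝ) • (-z'),
      hconv hz (hneg _ hz') (by norm_num) (by norm_num) (by norm_num),
      e, ⟨δ⁻¹ • e, hball ?_, smul_inv_smul₀ hδ.ne' e⟩, ?_⟩
    · rw [mem_closedBall_zero_iff, norm_smul, Real.norm_of_nonneg (by positivity),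
        inv_mul_le_iff₀ hδ]
      exact hen
    · simp only [he]
      module

theorem IsZonoid.exists_isZonoidWithSupport {Z : Set (EuclideanSpace ℝ (Fin n))}
    (hZ : IsZonoid Z) (hsym : Z = -Z) : ∃ p, IsZonoidWithSupport Z p := by
  obtain ⟨hconv, hcomp, hint⟩ := hZ.1
  have hneg : ∀ z ∈ Z, -z ∈ Z := fun z hz => by rw [hsym] at hz; exact hz
  have hne : Z.Nonempty := hint.mono interior_subset
  obtain ⟨r, hr, hball⟩ : ∃ r > 0, Metric.closedBall (0 : EuclideanSpace ℝ (Fin n)) r ⊆ Z := by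
    obtain ⟨x, hx⟩ := hint
    obtain ⟨r, hr, hb⟩ := Metric.nhds_basis_closedBall.mem_iff.1 (mem_interior_iff_mem_nhds.1 hx)
    refine ⟨r, hr, fun y hy => ?_⟩
    have h1 : x + y ∈ Z := hb (by simpa using hy)
    have h2 : x + -y ∈ Z := hb (by simpa using hy)
    have := hconv h1 (hneg _ h2) (by norm_num : (0 : ℝ) ≤ 2⁻¹) (by norm_num : (0 : ℝ) ≤ 2⁻¹)
      (by norm_num)
    convert this using 1
    module
  have hlub : ∀ x, IsLUB ((fun z => ⟪z, x⟫_ℝ) '' Z) (sSup ((fun z => ⟪z, x⟫_ℝ) '' Z)) := fun x =>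
    isLUB_csSup (hne.image _) (hcomp.image (by fun_prop)).bddAbove
  have hsmul : ∀ (t : ℝ) (x : EuclideanSpace ℝ (Fin n)),
      sSup ((fun z => ⟪z, t • x⟫_ℝ) '' Z) = ‖t‖ * sSup ((fun z => ⟪z, x⟫_ℝ) '' Z) := fun t x => by
    have key : (fun z => ⟪z, t • x⟫_ℝ) '' Z = |t| • ((fun z => ⟪z, x⟫_ℝ) '' Z) := by
      rw [← Set.image_smul, Set.image_image]
      rcases le_total 0 t with ht | ht
      · simp [abs_of_nonneg ht, inner_smul_right]
      · nth_rw 2 [hsym]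
        rw [← Set.image_neg_eq_neg, Set.image_image]
        simp [abs_of_nonpos ht, inner_smul_right]
    rw [key, Real.sSup_smul_of_nonneg (abs_nonneg t), smul_eq_mul, Real.norm_eq_abs]
  refine ⟨Seminorm.of (fun x => sSup ((fun z => ⟪z, x⟫_ℝ) '' Z)) (fun x y => ?_) hsmul,
    hconv, hcomp, hball (by simp [hr.le]), hlub, fun x hx => ?_,
    fun δ hδ => hZ.exists_sum_segment hsym hr hball hδ⟩
  · refine (hlub (x + y)).2 ?_
    rintro _ ⟨z, hz, rfl⟩
    simp only [inner_add_right]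
    exact add_le_add ((hlub x).1 ⟨z, hz, rfl⟩) ((hlub y).1 ⟨z, hz, rfl⟩)
  · by_contra h0
    have hx0 : 0 < ‖x‖ := norm_pos_iff.2 h0
    have h1 : ⟪(r / ‖x‖) • x, x⟫_ℝ ≤ 0 := by
      rw [← hx]
      refine (hlub x).1 ⟨_, hball ?_, rfl⟩
      rw [mem_closedBall_zero_iff, norm_smul, Real.norm_of_nonneg (by positivity),
        div_mul_cancel₀ _ hx0.ne']
    rw [inner_smul_left, real_inner_self_eq_norm_sq] at h1
    have : 0 < (r / ‖x‖) * ‖x‖ ^ 2 := by positivity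
    simp at h1
    linarith

theorem IsZonoidWithSupport.polarSet_eq {Z : Set (EuclideanSpace ℝ (Fin n))}
    {p : Seminorm ℝ (EuclideanSpace ℝ (Fin n))} (h : IsZonoidWithSupport Z p) :
    polarSet Z = {x | p x ≤ 1} := by
  ext x
  simp only [polarSet, Set.mem_ofPred_eq, isLUB_le_iff (h.isLUB x), upperBounds,
    Set.forall_mem_image]

theorem isCompact_stdCube (n : ℕ) : IsCompact (stdCube n) := by
  have : stdCube n = EuclideanSpace.equiv (Fin n) ℝ ⁻¹' Set.Icc (-1) 1 := by
    ext x
    simp [stdCube, abs_le, Pi.le_def, forall_and]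
  rw [this]
  exact (EuclideanSpace.equiv (Fin n) ℝ).toHomeomorph.isCompact_preimage.2 isCompact_Icc

theorem convex_stdCube (n : ℕ) : Convex ℝ (stdCube n) := by
  intro x hx y hy a b ha hb hab i
  have h1 := abs_le.1 (hx i)
  have h2 := abs_le.1 (hy i)
  simp only [PiLp.add_apply, PiLp.smul_apply, smul_eq_mul]
  rw [abs_le]
  constructor <;> nlinarith

theorem isLUB_inner_image_stdCube
    (T : EuclideanSpace ℝ (Fin n) →ₗ[ℝ] EuclideanSpace ℝ (Fin n)) (x : EuclideanSpace ℝ (Fin n)) :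
    IsLUB ((fun z => ⟪z, x⟫_ℝ) '' (T '' stdCube n))
      (∑ i, |⟪T (EuclideanSpace.single i 1), x⟫_ℝ|) := by
  have hT : ∀ y, ⟪T y, x⟫_ℝ = ∑ i, y i * ⟪T (EuclideanSpace.single i 1), x⟫_ℝ := fun y => by
    have hy : y = ∑ j, y j • EuclideanSpace.single j (1 : ℝ) := by
      ext i
      simp [Pi.single_apply]
    conv_lhs => rw [hy]
    simp [sum_inner, inner_smul_left]
  refine IsGreatest.isLUB ⟨?_, ?_⟩
  · refine ⟨_, ⟨WithLp.toLp 2 fun i => SignType.sign ⟪T (EuclideanSpace.single i 1), x⟫_ℝ, ?_,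
      rfl⟩, ?_⟩
    · intro i
      rcases lt_trichotomy ⟪T (EuclideanSpace.single i 1), x⟫_ℝ 0 with h | h | h
      · simp [sign_neg h]
      · simp [h]
      · simp [sign_pos h]
    · beta_reduce
      rw [hT]
      exact Finset.sum_congr rfl fun i _ => sign_mul_self _
  · rintro _ ⟨_, ⟨y, hy, rfl⟩, rfl⟩
    beta_reduce
    rw [hT]
    refine Finset.sum_le_sum fun i _ => (le_abs_self _).trans ?_
    rw [abs_mul]
    exact mul_le_of_le_one_left (abs_nonneg _) (hy i)

theorem exists_eq_image_stdCube {Z : Set (EuclideanSpace ℝ (Fin n))}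
    {p : Seminorm ℝ (EuclideanSpace ℝ (Fin n))} (h : IsZonoidWithSupport Z p)
    {u : Fin n → EuclideanSpace ℝ (Fin n)} (hu : ∀ x, p x = ∑ j, |⟪u j, x⟫_ℝ|) :
    ∃ T : EuclideanSpace ℝ (Fin n) ≃ₗ[ℝ] EuclideanSpace ℝ (Fin n), Z = T '' stdCube n := by
  have hspan : ⊤ ≤ Submodule.span ℝ (Set.range u) := by
    rw [top_le_iff, ← Submodule.orthogonal_eq_bot_iff, Submodule.eq_bot_iff]
    intro x hx
    refine h.eq_zero x ?_
    rw [hu]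
    refine Finset.sum_eq_zero fun j _ => ?_
    rw [(Submodule.mem_orthogonal _ _).1 hx _ (Submodule.subset_span ⟨j, rfl⟩), abs_zero]
  have hli : LinearIndependent ℝ u := linearIndependent_of_top_le_span_of_card_eq_finrank hspan
    (by simp)
  let T := (EuclideanSpace.basisFun (Fin n) ℝ).toBasis.equiv (Module.Basis.mk hli hspan)
    (Equiv.refl _)
  have hT : ∀ i, T (EuclideanSpace.single i 1) = u i := fun i => by
    have := (EuclideanSpace.basisFun (Fin n) ℝ).toBasis.equiv_apply i (Module.Basis.mk hli hspan)
      (Equiv.refl _)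
    simpa using this
  have hlub : ∀ x, IsLUB ((fun z => ⟪z, x⟫_ℝ) '' (T '' stdCube n)) (p x) := fun x => by
    have := isLUB_inner_image_stdCube T.toLinearMap x
    simp only [LinearEquiv.coe_coe, hT] at this
    rwa [hu]
  have hcont : Continuous T := T.toLinearMap.continuous_of_finiteDimensional
  refine ⟨T, Set.Subset.antisymm (fun z hz => ?_) fun z hz => ?_⟩
  · exact mem_of_forall_inner_le ((convex_stdCube n).linear_image T.toLinearMap)
      ((isCompact_stdCube n).image hcont).isClosed hlub fun x => h.inner_le hz x
  · exact mem_of_forall_inner_le h.convex h.isCompact.isClosed h.isLUB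
      fun x => (hlub x).1 ⟨z, hz, rfl⟩

theorem volume_stdCube (n : ℕ) : volume (stdCube n) = 2 ^ n := by
  have : stdCube n = WithLp.ofLp ⁻¹' Set.Icc (-1 : Fin n → ℝ) 1 := by
    ext x
    simp [stdCube, abs_le, Pi.le_def, forall_and]
  rw [this, (PiLp.volume_preserving_ofLp (Fin n)).measure_preimage
    measurableSet_Icc.nullMeasurableSet, Real.volume_Icc_pi]
  norm_num

theorem volume_sum_abs_le_one (n : ℕ) :
    volume {x : EuclideanSpace ℝ (Fin n) | ∑ i, |x i| ≤ 1} = 2 ^ n / (Nat.factorial n : ℝ≥0∞) := by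
  have hpre : {x : EuclideanSpace ℝ (Fin n) | ∑ i, |x i| ≤ 1} =
    WithLp.ofLp ⁻¹' {x : Fin n → ℝ | ∑ i, |x i| ≤ 1} := rfl
  rw [hpre, (PiLp.volume_preserving_ofLp (Fin n)).measure_preimage
    (measurableSet_le (by fun_prop) (by fun_prop)).nullMeasurableSet]
  rcases Nat.eq_zero_or_pos n with rfl | hn
  · simp [volume_pi]
  · have : Nonempty (Fin n) := ⟨⟨0, hn⟩⟩
    have h := volume_sum_rpow_le (Fin n) le_rfl 1
    simp only [Real.rpow_one, div_one, Fintype.card_fin, ENNReal.ofReal_one, one_pow, one_mul] at h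
    rw [h, Real.Gamma_nat_eq_factorial, one_add_one_eq_two, Real.Gamma_two, mul_one,
      ENNReal.ofReal_div_of_pos (by positivity), ENNReal.ofReal_pow (by norm_num)]
    simp

theorem volume_image_stdCube_mul_volume_polarSet
    (T : EuclideanSpace ℝ (Fin n) ≃ₗ[ℝ] EuclideanSpace ℝ (Fin n)) :
    volume (T '' stdCube n) * volume (polarSet (T '' stdCube n)) =
      4 ^ n / (Nat.factorial n : ℝ≥0∞) := by
  have hdet : LinearMap.det (LinearMap.adjoint T.toLinearMap) = LinearMap.det T.toLinearMap := by
    let b := EuclideanSpace.basisFun (Fin n) ℝ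
    rw [← LinearMap.det_toMatrix b.toBasis, LinearMap.toMatrix_adjoint, Matrix.det_conjTranspose,
      LinearMap.det_toMatrix, star_trivial]
  have hT : LinearMap.det T.toLinearMap ≠ 0 := T.isUnit_det'.ne_zero
  have hpolar : polarSet (T '' stdCube n) =
      LinearMap.adjoint T.toLinearMap ⁻¹' {x | ∑ i, |x i| ≤ 1} := by
    ext x
    have h1 : x ∈ polarSet (T '' stdCube n) ↔
        ∑ i, |⟪T (EuclideanSpace.single i 1), x⟫_ℝ| ≤ 1 := by
      refine Iff.trans ?_ (isLUB_le_iff (isLUB_inner_image_stdCube T.toLinearMap x)).symm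
      simp only [polarSet, Set.mem_ofPred_eq, upperBounds, Set.forall_mem_image,
        LinearEquiv.coe_coe]
    have h2 : ∀ i, ⟪T (EuclideanSpace.single i 1), x⟫_ℝ =
        (LinearMap.adjoint T.toLinearMap x) i := fun i => by
      have := LinearMap.adjoint_inner_right T.toLinearMap (EuclideanSpace.single i 1) x
      rw [LinearEquiv.coe_coe] at this
      rw [← this, EuclideanSpace.inner_single_left, map_one, one_mul]
    simp only [h1, h2, Set.mem_preimage, Set.mem_ofPred_eq]
  have h3 := Measure.addHaar_image_linearMap volume T.toLinearMap (stdCube n)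
  rw [LinearEquiv.coe_coe] at h3
  rw [hpolar, h3, Measure.addHaar_preimage_linearMap _ (by rwa [hdet]), hdet, volume_stdCube,
    volume_sum_abs_le_one, mul_mul_mul_comm, ← ENNReal.ofReal_mul (abs_nonneg _), ← abs_mul,
    mul_inv_cancel₀ hT, abs_one, ENNReal.ofReal_one, one_mul, ← mul_div_assoc, ← mul_pow]
  norm_num

end EuclideanSpace

/-- Reisner's theorem: a centrally symmetric zonoid `Z ⊆ ℝⁿ` satisfies
`vol(Z)·vol(Z*) ≥ 4ⁿ/n!`, with equality iff `Z` is a parallelepiped, i.e. an invertible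
linear image of the cube `[-1,1]ⁿ`. -/
theorem reisner_zonoids (n : ℕ) (Z : Set (EuclideanSpace ℝ (Fin n)))
    (hZ : IsZonoid Z) (hsym : Z = -Z) :
    (4 : ℝ≥0∞) ^ n / (Nat.factorial n : ℝ≥0∞) ≤ volume Z * volume (polarSet Z) ∧
    (volume Z * volume (polarSet Z) = (4 : ℝ≥0∞) ^ n / (Nat.factorial n : ℝ≥0∞) ↔
      ∃ T : EuclideanSpace ℝ (Fin n) ≃ₗ[ℝ] EuclideanSpace ℝ (Fin n),
        Z = T '' stdCube n) := by
  obtain ⟨p, h⟩ := hZ.exists_isZonoidWithSupport hsym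
  obtain ⟨h1, h2⟩ := h.four_pow_le_and (n := n) (by simp)
  have hvol : volume Z * volume (polarSet Z) =
      volume Z * expIntegral p / (Nat.factorial n : ℝ≥0∞) := by
    rw [h.polarSet_eq, volume_le_one_eq p h.eq_zero, mul_div_assoc, finrank_euclideanSpace_fin]
  refine ⟨?_, fun heq => ?_, ?_⟩
  · rw [hvol]
    gcongr
  · have hn0 : (Nat.factorial n : ℝ≥0∞) ≠ 0 := by simp [Nat.factorial_ne_zero]
    have hn : volume Z * expIntegral p = 4 ^ n := by
      rw [← ENNReal.div_mul_cancel (b := volume Z * expIntegral p) hn0 (by simp), ← hvol, heq,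
        ENNReal.div_mul_cancel hn0 (by simp)]
    obtain ⟨u, hu⟩ := h2 hn
    exact exists_eq_image_stdCube h hu
  · rintro ⟨T, rfl⟩
    exact volume_image_stdCube_mul_volume_polarSet T
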